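/- arXiv:2110.14741 — 6 statements merged into one kernel-verified Lean document; each statement's English description precedes it below -/
import Mathlib

section
/- Let α ∈ (0,2). Let X_1, X_2, … be independent identically distributed real random variables whose common distribution is symmetric about 0 and has a probability density function f satisfying f(u) ≍ u^{-1-α} as u → ∞. For n ∈ ℕ let S_n := X_1 + … + X_n. Then for any sequences (n_k) of positive integers, (x_k) of positive reals, and (c_k), (b_k) of reals in (0,1) such that n_k / x_k^α → 0, (n_k x_k^{-α}) / c_k^{2α} → 0, and (n_k x_k^{-α}) / (b_k^2 c_k^{α-2}) → 0, one has P(S_{n_k} > x_k) ∼ P( S_{n_k} > x_k and there exists i ∈ {1,…,n_k} with X_i > x_k, |S_{n_k} − X_i| ≤ b_k x_k, and max_{j ∈ {1,…,n_k}, j ≠ i} |X_j| ≤ c_k x_k ), i.e., the ratio of the two probabilities tends to 1 as k → ∞. -/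
open MeasureTheory ProbabilityTheory Filter

/-- truncation at level `t` -/
noncomputable def trunc (t y : ℝ) : ℝ := if |y| ≤ t then y else 0

lemma trunc_meas (t : ℝ) : Measurable (trunc t) := by
  unfold trunc
  exact Measurable.ite (measurableSet_le measurable_id.abs measurable_const) measurable_id measurable_const

lemma trunc_abs_le (t y : ℝ) (ht : 0 ≤ t) : |trunc t y| ≤ t := by
  unfold trunc; split_ifs with h
  · exact h
  · simpa using ht

lemma trunc_neg (t y : ℝ) : trunc t (-y) = - trunc t y := by
  unfold trunc; rw [abs_neg]; split_ifs <;> simp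

lemma law_mean (μ : Measure ℝ) (hs : μ = μ.map (fun y => -y)) (t : ℝ) : ∫ y, trunc t y ∂μ = 0 := by
  have h : ∫ y, trunc t y ∂μ = ∫ y, trunc t (-y) ∂μ := by
    conv_lhs => rw [hs]
    rw [integral_map measurable_neg.aemeasurable (trunc_meas t).aestronglyMeasurable]
  simp only [trunc_neg, integral_neg] at h
  linarith

lemma law_upper (μ : Measure ℝ) (f : ℝ → ℝ) (α K0 u0 : ℝ) (hα : 0 < α) (hK0 : 0 < K0) (hu0 : 0 < u0)
    (hpdf : μ = (volume : Measure ℝ).withDensity (fun u => ENNReal.ofReal (f u)))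
    (htail : ∀ u, u0 ≤ u → f u ≤ K0 * u ^ (-1 - α)) (t : ℝ) (ht : u0 ≤ t) :
    μ (Set.Ioi t) ≤ ENNReal.ofReal (K0 / α * t ^ (-α)) := by
  have ht0 : 0 < t := lt_of_lt_of_le hu0 ht
  rw [hpdf, withDensity_apply _ measurableSet_Ioi]
  calc ∫⁻ u in Set.Ioi t, ENNReal.ofReal (f u)
      ≤ ∫⁻ u in Set.Ioi t, ENNReal.ofReal (K0 * u ^ (-1 - α)) := by
        apply setLIntegral_mono' measurableSet_Ioi
        intro u hu
        exact ENNReal.ofReal_le_ofReal (htail u (ht.trans (le_of_lt hu)))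
    _ = ENNReal.ofReal (∫ u in Set.Ioi t, K0 * u ^ (-1 - α)) := by
        rw [ofReal_integral_eq_lintegral_ofReal]
        · exact (integrableOn_Ioi_rpow_of_lt (by linarith) ht0).const_mul K0
        · filter_upwards [ae_restrict_mem measurableSet_Ioi] with u hu
          have : 0 < u := ht0.trans hu
          simp only [Pi.zero_apply]; positivity
    _ = _ := by
        rw [integral_const_mul, integral_Ioi_rpow_of_lt (by linarith) ht0]
        congr 1
        rw [show -1 - α + 1 = -α by ring]
        field_simp

lemma law_lower (μ : Measure ℝ) (f : ℝ → ℝ) (α k0 u0 : ℝ) (hα : 0 < α) (hK0 : 0 < k0) (hu0 : 0 < u0)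
    (hpdf : μ = (volume : Measure ℝ).withDensity (fun u => ENNReal.ofReal (f u)))
    (htail : ∀ u, u0 ≤ u → k0 * u ^ (-1 - α) ≤ f u) (t : ℝ) (ht : u0 ≤ t) :
    ENNReal.ofReal (k0 / α * t ^ (-α)) ≤ μ (Set.Ioi t) := by
  have ht0 : 0 < t := lt_of_lt_of_le hu0 ht
  rw [hpdf, withDensity_apply _ measurableSet_Ioi]
  calc _ = ENNReal.ofReal (∫ u in Set.Ioi t, k0 * u ^ (-1 - α)) := by
        rw [integral_const_mul, integral_Ioi_rpow_of_lt (by linarith) ht0]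
        congr 1
        rw [show -1 - α + 1 = -α by ring]
        field_simp
    _ = ∫⁻ u in Set.Ioi t, ENNReal.ofReal (k0 * u ^ (-1 - α)) := by
        rw [ofReal_integral_eq_lintegral_ofReal]
        · exact (integrableOn_Ioi_rpow_of_lt (by linarith) ht0).const_mul k0
        · filter_upwards [ae_restrict_mem measurableSet_Ioi] with u hu
          have : 0 < u := ht0.trans hu
          simp only [Pi.zero_apply]; positivity
    _ ≤ _ := by
        apply setLIntegral_mono' measurableSet_Ioi
        intro u hu
        exact ENNReal.ofReal_le_ofReal (htail u (ht.trans (le_of_lt hu)))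

lemma law_dens (μ : Measure ℝ) (f : ℝ → ℝ) (α K0 u0 : ℝ) (hα : 0 < α) (hK0 : 0 < K0) (hu0 : 0 < u0)
    (hpdf : μ = (volume : Measure ℝ).withDensity (fun u => ENNReal.ofReal (f u)))
    (htail : ∀ u, u0 ≤ u → f u ≤ K0 * u ^ (-1 - α)) (t η : ℝ) (ht : 2 * u0 ≤ t) (hη : 0 < η)
    (hη2 : η ≤ 1 / 2) :
    μ (Set.Ioc ((1 - η) * t) t) ≤ ENNReal.ofReal (K0 * 2 ^ (1 + α) * η * t ^ (-α)) := by
  have ht0 : 0 < t := by linarith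
  rw [hpdf, withDensity_apply _ measurableSet_Ioc]
  calc ∫⁻ u in Set.Ioc ((1 - η) * t) t, ENNReal.ofReal (f u)
      ≤ ∫⁻ u in Set.Ioc ((1 - η) * t) t, ENNReal.ofReal (K0 * (t / 2) ^ (-1 - α)) := by
        apply setLIntegral_mono' measurableSet_Ioc
        intro u hu
        have h1 : t / 2 ≤ u := by nlinarith [hu.1]
        apply ENNReal.ofReal_le_ofReal
        refine (htail u (by linarith)).trans ?_
        gcongr K0 * ?_
        exact Real.rpow_le_rpow_of_nonpos (by positivity) h1 (by linarith)
    _ = ENNReal.ofReal (K0 * (t / 2) ^ (-1 - α) * (η * t)) := by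
        rw [setLIntegral_const, Real.volume_Ioc, ← ENNReal.ofReal_mul (by positivity)]
        congr 2; ring
    _ = _ := by
        congr 1
        rw [Real.div_rpow ht0.le (by norm_num), show -1 - α = -(1 + α) by ring,
          Real.rpow_neg (by norm_num : (0:ℝ) ≤ 2), show -(1 + α) = -α - 1 by ring, Real.rpow_sub_one ht0.ne']
        field_simp

lemma law_var (μ : Measure ℝ) [IsProbabilityMeasure μ] (f : ℝ → ℝ) (α K0 u0 : ℝ) (hα : 0 < α) (hα2 : α < 2)
    (hK0 : 0 < K0) (hu0 : 0 < u0) (hf : Measurable f)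
    (hs : μ = μ.map (fun y => -y))
    (hpdf : μ = (volume : Measure ℝ).withDensity (fun u => ENNReal.ofReal (f u)))
    (htail : ∀ u, u0 ≤ u → f u ≤ K0 * u ^ (-1 - α)) (t : ℝ) (ht : u0 ≤ t) :
    ∫ y, trunc t y ^ 2 ∂μ ≤ (u0 ^ α + 2 * (K0 / (2 - α))) * t ^ (2 - α) := by
  have ht0 : 0 < t := lt_of_lt_of_le hu0 ht
  set h : ℝ → ℝ := (Set.Ioc u0 t).indicator (fun y => y ^ 2) with hh
  have hhm : Measurable h := (measurable_id.pow_const 2).indicator measurableSet_Ioc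
  have hh0 : ∀ y, 0 ≤ h y := fun y => Set.indicator_nonneg (fun y _ => sq_nonneg y) y
  have hhb : ∀ y, h y ≤ t ^ 2 := by
    intro y
    by_cases hy : y ∈ Set.Ioc u0 t
    · rw [hh, Set.indicator_of_mem hy]
      have := hy.1; have := hy.2
      gcongr
      linarith
    · rw [hh, Set.indicator_of_notMem hy]; positivity
  have hhi : Integrable h μ := by
    refine Integrable.of_bound hhm.aestronglyMeasurable (t ^ 2) (ae_of_all _ fun y => ?_)
    rw [Real.norm_eq_abs, abs_of_nonneg (hh0 y)]; exact hhb y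
  have hhi' : Integrable (fun y => h (-y)) μ := by
    refine Integrable.of_bound (hhm.comp measurable_neg).aestronglyMeasurable (t ^ 2) (ae_of_all _ fun y => ?_)
    rw [Real.norm_eq_abs, abs_of_nonneg (hh0 _)]; exact hhb _
  have hsym : ∫ y, h (-y) ∂μ = ∫ y, h y ∂μ := by
    conv_rhs => rw [hs]
    rw [integral_map measurable_neg.aemeasurable hhm.aestronglyMeasurable]
  have hI : ∫ y, h y ∂μ ≤ K0 / (2 - α) * t ^ (2 - α) := by
    rw [integral_eq_lintegral_of_nonneg_ae (ae_of_all _ hh0) hhm.aestronglyMeasurable]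
    apply ENNReal.toReal_le_of_le_ofReal
    · have : 0 < 2 - α := by linarith
      positivity
    rw [hpdf, lintegral_withDensity_eq_lintegral_mul _ hf.ennreal_ofReal hhm.ennreal_ofReal]
    calc _ ≤ ∫⁻ u, (Set.Ioc u0 t).indicator (fun u => ENNReal.ofReal (K0 * u ^ (1 - α))) u := by
          apply lintegral_mono
          intro u
          by_cases hu : u ∈ Set.Ioc u0 t
          · simp only [Pi.mul_apply, hh, Set.indicator_of_mem hu]
            rw [← ENNReal.ofReal_mul' (sq_nonneg u)]
            apply ENNReal.ofReal_le_ofReal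
            have hu1 : 0 < u := hu0.trans hu.1
            calc f u * u ^ 2 ≤ K0 * u ^ (-1 - α) * u ^ 2 := by
                  gcongr; exact htail u hu.1.le
              _ = K0 * u ^ (1 - α) := by
                  rw [mul_assoc, ← Real.rpow_natCast u 2, ← Real.rpow_add hu1]
                  congr 2; push_cast; ring
          · simp [hh, Set.indicator_of_notMem hu]
      _ = ∫⁻ u in Set.Ioc u0 t, ENNReal.ofReal (K0 * u ^ (1 - α)) := by
          rw [lintegral_indicator measurableSet_Ioc]
      _ = ENNReal.ofReal (∫ u in Set.Ioc u0 t, K0 * u ^ (1 - α)) := by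
          rw [ofReal_integral_eq_lintegral_ofReal]
          · have := (intervalIntegral.intervalIntegrable_rpow' (a := u0) (b := t) (r := 1 - α) (by linarith)).const_mul K0
            rwa [intervalIntegrable_iff_integrableOn_Ioc_of_le ht] at this
          · filter_upwards [ae_restrict_mem measurableSet_Ioc] with u hu
            have : 0 < u := hu0.trans hu.1
            simp only [Pi.zero_apply]; positivity
      _ ≤ _ := by
          apply ENNReal.ofReal_le_ofReal
          rw [← intervalIntegral.integral_of_le ht, intervalIntegral.integral_const_mul,
            integral_rpow (Or.inl (by linarith)), show 1 - α + 1 = 2 - α by ring, div_mul_eq_mul_div, mul_div_assoc']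
          have h2 : 0 < 2 - α := by linarith
          have h3 : 0 ≤ u0 ^ (2 - α) := by positivity
          gcongr
          linarith
  have hmain : ∫ y, trunc t y ^ 2 ∂μ ≤ ∫ y, (u0 ^ 2 + h y + h (-y)) ∂μ := by
    apply integral_mono_of_nonneg (ae_of_all _ fun y => sq_nonneg _)
    · exact ((integrable_const _).add hhi).add hhi'
    · refine ae_of_all _ fun y => ?_
      have a1 := hh0 y
      have a2 := hh0 (-y)
      simp only
      by_cases hy : |y| ≤ t
      · simp only [trunc, hy, if_true]
        by_cases hy2 : |y| ≤ u0
        · have : y ^ 2 ≤ u0 ^ 2 := sq_le_sq' (by linarith [neg_le_of_abs_le hy2]) (le_of_abs_le hy2)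
          linarith
        · push Not at hy2
          rcases le_or_gt 0 y with h0 | h0
          · rw [abs_of_nonneg h0] at hy hy2
            have : h y = y ^ 2 := Set.indicator_of_mem (show y ∈ Set.Ioc u0 t from ⟨hy2, hy⟩) _
            nlinarith
          · rw [abs_of_neg h0] at hy hy2
            have : h (-y) = (-y) ^ 2 := Set.indicator_of_mem (show -y ∈ Set.Ioc u0 t from ⟨hy2, hy⟩) _
            nlinarith
      · simp only [trunc, hy, if_false]
        have := sq_nonneg u0
        nlinarith
  have e1 : ∫ y, (u0 ^ 2 + h y + h (-y)) ∂μ = ∫ y, (u0 ^ 2 + h y) ∂μ + ∫ y, h (-y) ∂μ :=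
    integral_add ((integrable_const _).add hhi) hhi'
  have e2 : ∫ y, (u0 ^ 2 + h y) ∂μ = ∫ y, u0 ^ 2 ∂μ + ∫ y, h y ∂μ :=
    integral_add (integrable_const _) hhi
  rw [e1, e2, hsym] at hmain
  simp only [integral_const, probReal_univ, smul_eq_mul, one_mul] at hmain
  have hu : u0 ^ 2 ≤ u0 ^ α * t ^ (2 - α) := by
    calc u0 ^ 2 = u0 ^ α * u0 ^ (2 - α) := by
          rw [← Real.rpow_natCast u0 2, ← Real.rpow_add hu0]; congr 1; push_cast; ring
      _ ≤ _ := by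
          gcongr
  linarith

lemma cheb {Ω : Type*} [MeasurableSpace Ω] (P : Measure Ω) [IsProbabilityMeasure P] (μ : Measure ℝ)
    (X : ℕ → Ω → ℝ) (hmeas : ∀ i, Measurable (X i)) (hindep : iIndepFun X P)
    (hlaw : ∀ i, P.map (X i) = μ) (t V y : ℝ) (ht : 0 ≤ t) (hy : 0 < y)
    (hmean : ∫ z, trunc t z ∂μ = 0) (hvar : ∫ z, trunc t z ^ 2 ∂μ ≤ V) (J : Finset ℕ) :
    P.real {ω | y ≤ |∑ j ∈ J, trunc t (X j ω)|} ≤ J.card * V / y ^ 2 := by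
  set Y : ℕ → Ω → ℝ := fun j ω => trunc t (X j ω) with hY
  have hYm : ∀ j, Measurable (Y j) := fun j => (trunc_meas t).comp (hmeas j)
  have hYL : ∀ j, MemLp (Y j) 2 P := fun j =>
    MemLp.of_bound (hYm j).aestronglyMeasurable t (ae_of_all _ fun ω => by
      simpa using trunc_abs_le t (X j ω) ht)
  have hmeanY : ∀ j, ∫ ω, Y j ω ∂P = 0 := by
    intro j
    rw [← hmean, ← hlaw j, integral_map (hmeas j).aemeasurable (trunc_meas t).aestronglyMeasurable]
  have hvarY : ∀ j, variance (Y j) P ≤ V := by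
    intro j
    rw [variance_of_integral_eq_zero (hYm j).aemeasurable (hmeanY j)]
    refine le_trans (le_of_eq ?_) hvar
    rw [← hlaw j, integral_map (hmeas j).aemeasurable ((trunc_meas t).pow_const 2).aestronglyMeasurable]
  have hind : Set.Pairwise (J : Set ℕ) fun i j => IndepFun (Y i) (Y j) P := by
    intro i _ j _ hij
    exact (hindep.indepFun hij).comp (trunc_meas t) (trunc_meas t)
  have hv := IndepFun.variance_sum (s := J) (fun i _ => hYL i) hind
  have hm : ∫ ω, (∑ j ∈ J, Y j) ω ∂P = 0 := by
    simp only [Finset.sum_apply]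
    rw [integral_finsetSum _ (fun j _ => (hYL j).integrable (by norm_num))]
    exact Finset.sum_eq_zero fun j _ => hmeanY j
  have hc := meas_ge_le_variance_div_sq (memLp_finsetSum' J fun i _ => hYL i) hy
  rw [hm] at hc
  have hset : {ω | y ≤ |∑ j ∈ J, trunc t (X j ω)|} = {ω | y ≤ |(∑ j ∈ J, Y j) ω - 0|} := by
    ext ω; simp [hY]
  rw [hset]
  have h1 : variance (∑ j ∈ J, Y j) P ≤ J.card * V := by
    rw [hv]
    calc _ ≤ ∑ j ∈ J, V := Finset.sum_le_sum fun j _ => hvarY j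
      _ = _ := by simp
  refine (ENNReal.toReal_le_of_le_ofReal ?_ hc).trans ?_
  · exact div_nonneg (variance_nonneg _ _) (sq_nonneg _)
  · gcongr

lemma law_real {Ω : Type*} [MeasurableSpace Ω] (P : Measure Ω) [IsProbabilityMeasure P] (μ : Measure ℝ)
    (X : ℕ → Ω → ℝ) (hmeas : ∀ i, Measurable (X i))
    (hlaw : ∀ i, P.map (X i) = μ) (B : Set ℝ) (hB : MeasurableSet B) (i : ℕ) :
    P.real (X i ⁻¹' B) = μ.real B := by
  rw [← hlaw i, map_measureReal_apply (hmeas i) hB]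

lemma jumpU {Ω : Type*} [MeasurableSpace Ω] (P : Measure Ω) [IsProbabilityMeasure P] (μ : Measure ℝ)
    (X : ℕ → Ω → ℝ) (hmeas : ∀ i, Measurable (X i)) (hindep : iIndepFun X P)
    (hlaw : ∀ i, P.map (X i) = μ) (t V y : ℝ) (ht : 0 ≤ t) (hy : 0 < y)
    (hmean : ∫ z, trunc t z ∂μ = 0) (hvar : ∫ z, trunc t z ^ 2 ∂μ ≤ V)
    (B : Set ℝ) (hB : MeasurableSet B) (n : ℕ) :
    P.real {ω | ∃ i ∈ Finset.range n, X i ω ∈ B ∧ y ≤ |∑ j ∈ (Finset.range n).erase i, trunc t (X j ω)|}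
      ≤ n * (μ.real B * (n * V / y ^ 2)) := by
  have hV : 0 ≤ V := le_trans (integral_nonneg fun z => sq_nonneg _) hvar
  have hset : {ω | ∃ i ∈ Finset.range n, X i ω ∈ B ∧ y ≤ |∑ j ∈ (Finset.range n).erase i, trunc t (X j ω)|}
      = ⋃ i ∈ Finset.range n, (X i ⁻¹' B ∩ {ω | y ≤ |∑ j ∈ (Finset.range n).erase i, trunc t (X j ω)|}) := by
    ext ω
    simp only [Set.mem_iUnion, exists_prop]
    rfl
  rw [hset]
  refine (measureReal_biUnion_finset_le _ _).trans ?_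
  calc _ ≤ ∑ i ∈ Finset.range n, (μ.real B * (n * V / y ^ 2)) := by
        apply Finset.sum_le_sum
        intro i hi
        have hI := hindep.indepFun_finset {i} ((Finset.range n).erase i) (by simp) hmeas
        let φ : (({i} : Finset ℕ) → ℝ) → ℝ := fun v => v ⟨i, by simp⟩
        let ψ : (((Finset.range n).erase i : Finset ℕ) → ℝ) → ℝ := fun v => ∑ j, trunc t (v j)
        have hφ : Measurable φ := measurable_pi_apply _
        have hψ : Measurable ψ := Finset.measurable_sum _ fun j _ => (trunc_meas t).comp (measurable_pi_apply j)
        have hI2 := hI.comp hφ hψ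
        have e := hI2.measure_inter_preimage_eq_mul B {z | y ≤ |z|} hB
          (measurableSet_le measurable_const measurable_id.abs)
        have e1 : (φ ∘ fun a (i_1 : ({i} : Finset ℕ)) => X i_1 a) ⁻¹' B = X i ⁻¹' B := rfl
        have e2 : (ψ ∘ fun a (k : ((Finset.range n).erase i : Finset ℕ)) => X k a) ⁻¹' {z | y ≤ |z|}
            = {ω | y ≤ |∑ j ∈ (Finset.range n).erase i, trunc t (X j ω)|} := by
          ext ω
          simp only [Set.mem_preimage, Function.comp, Set.mem_ofPred_eq, ψ]
          rw [Finset.sum_coe_sort ((Finset.range n).erase i) (fun j => trunc t (X j ω))]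
        rw [e1, e2] at e
        have e3 := congrArg ENNReal.toReal e
        rw [ENNReal.toReal_mul] at e3
        change P.real _ = P.real _ * P.real _ at e3
        rw [e3, law_real P μ X hmeas hlaw B hB]
        gcongr
        refine (cheb P μ X hmeas hindep hlaw t V y ht hy hmean hvar _).trans ?_
        gcongr
        calc _ ≤ (Finset.range n).card := Finset.card_erase_le
          _ = n := by simp
    _ = _ := by simp

lemma pairU {Ω : Type*} [MeasurableSpace Ω] (P : Measure Ω) [IsProbabilityMeasure P] (μ : Measure ℝ)
    (X : ℕ → Ω → ℝ) (hmeas : ∀ i, Measurable (X i)) (hindep : iIndepFun X P)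
    (hlaw : ∀ i, P.map (X i) = μ) (B : Set ℝ) (hB : MeasurableSet B) (n : ℕ) :
    P.real {ω | ∃ i ∈ Finset.range n, ∃ j ∈ Finset.range n, j ≠ i ∧ X i ω ∈ B ∧ X j ω ∈ B}
      ≤ (n * μ.real B) ^ 2 := by
  have hset : {ω | ∃ i ∈ Finset.range n, ∃ j ∈ Finset.range n, j ≠ i ∧ X i ω ∈ B ∧ X j ω ∈ B}
      ⊆ ⋃ i ∈ Finset.range n, ⋃ j ∈ (Finset.range n).erase i, (X i ⁻¹' B ∩ X j ⁻¹' B) := by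
    rintro ω ⟨i, hi, j, hj, hij, h1, h2⟩
    simp only [Set.mem_iUnion]
    exact ⟨i, hi, j, Finset.mem_erase.2 ⟨hij, hj⟩, h1, h2⟩
  refine (measureReal_mono hset (measure_ne_top _ _)).trans ((measureReal_biUnion_finset_le _ _).trans ?_)
  calc _ ≤ ∑ i ∈ Finset.range n, ∑ j ∈ Finset.range n, (μ.real B * μ.real B) := by
        apply Finset.sum_le_sum
        intro i hi
        refine (measureReal_biUnion_finset_le _ _).trans ?_
        refine le_trans ?_ (Finset.sum_le_sum_of_subset_of_nonneg (Finset.erase_subset i _) fun _ _ _ => by positivity)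
        apply Finset.sum_le_sum
        intro j hj
        have hij : i ≠ j := (Finset.ne_of_mem_erase hj).symm
        have e3 := congrArg ENNReal.toReal ((hindep.indepFun hij).measure_inter_preimage_eq_mul B B hB hB)
        rw [ENNReal.toReal_mul] at e3
        change P.real _ = P.real _ * P.real _ at e3
        rw [e3, law_real P μ X hmeas hlaw B hB, law_real P μ X hmeas hlaw B hB]
    _ = _ := by simp; ring

lemma singleU {Ω : Type*} [MeasurableSpace Ω] (P : Measure Ω) [IsProbabilityMeasure P] (μ : Measure ℝ)
    (X : ℕ → Ω → ℝ) (hmeas : ∀ i, Measurable (X i))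
    (hlaw : ∀ i, P.map (X i) = μ) (B : Set ℝ) (hB : MeasurableSet B) (n : ℕ) :
    P.real {ω | ∃ i ∈ Finset.range n, X i ω ∈ B} ≤ n * μ.real B := by
  have hset : {ω | ∃ i ∈ Finset.range n, X i ω ∈ B} = ⋃ i ∈ Finset.range n, X i ⁻¹' B := by
    ext ω; simp
  rw [hset]
  refine (measureReal_biUnion_finset_le _ _).trans (le_of_eq ?_)
  simp [law_real P μ X hmeas hlaw B hB]

lemma singleL {Ω : Type*} [MeasurableSpace Ω] (P : Measure Ω) [IsProbabilityMeasure P] (μ : Measure ℝ)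
    [IsProbabilityMeasure μ]
    (X : ℕ → Ω → ℝ) (hmeas : ∀ i, Measurable (X i)) (hindep : iIndepFun X P)
    (hlaw : ∀ i, P.map (X i) = μ) (B : Set ℝ) (hB : MeasurableSet B) (n : ℕ) (hn : n * μ.real B ≤ 1) :
    n * μ.real B / 2 ≤ P.real {ω | ∃ i ∈ Finset.range n, X i ω ∈ B} := by
  have hset : {ω | ∃ i ∈ Finset.range n, X i ω ∈ B} = (⋂ i ∈ Finset.range n, X i ⁻¹' Bᶜ)ᶜ := by
    ext ω; simp
  have hm : MeasurableSet (⋂ i ∈ Finset.range n, X i ⁻¹' Bᶜ) :=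
    Finset.measurableSet_biInter _ fun i _ => hmeas i hB.compl
  have e := congrArg ENNReal.toReal (hindep.measure_inter_preimage_eq_mul (Finset.range n)
    (sets := fun _ => Bᶜ) (fun _ _ => hB.compl))
  rw [ENNReal.toReal_prod] at e
  change P.real _ = ∏ i ∈ _, P.real _ at e
  rw [hset, probReal_compl_eq_one_sub hm, e]
  simp only [law_real P μ X hmeas hlaw _ hB.compl, Finset.prod_const, Finset.card_range,
    probReal_compl_eq_one_sub hB]
  set q := μ.real B
  have hq0 : 0 ≤ q := measureReal_nonneg
  have hq1 : q ≤ 1 := measureReal_le_one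
  have h1 : 1 + n * q ≤ (1 + q) ^ n := one_add_mul_le_pow (by linarith) n
  have h2 : (1 - q) ^ n * (1 + q) ^ n ≤ 1 := by
    rw [← mul_pow]; apply pow_le_one₀ <;> nlinarith
  have h3 : 0 ≤ (1 - q) ^ n := pow_nonneg (by linarith) n
  have h4 : (1 - q) ^ n * (1 + n * q) ≤ 1 := le_trans (by gcongr) h2
  have h5 : 0 ≤ n * q := by positivity
  nlinarith

lemma law_consts (μ : Measure ℝ) [IsProbabilityMeasure μ] (α : ℝ) (hα : α ∈ Set.Ioo (0 : ℝ) 2)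
    (hs : μ = μ.map (fun y => -y))
    (f : ℝ → ℝ) (hfmeas : Measurable f)
    (hpdf : μ = (volume : Measure ℝ).withDensity (fun u => ENNReal.ofReal (f u)))
    (k0 K0 u0 : ℝ) (hk0 : 0 < k0) (hK0 : k0 ≤ K0) (hu0 : 0 < u0)
    (htail : ∀ u, u0 ≤ u → k0 * u ^ (-1 - α) ≤ f u ∧ f u ≤ K0 * u ^ (-1 - α)) :
    ∃ C κ : ℝ, 0 < C ∧ 0 < κ ∧ (∀ t, u0 ≤ t → μ.real {y | t < |y|} ≤ C * t ^ (-α)) ∧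
      (∀ t, u0 ≤ t → κ * t ^ (-α) ≤ μ.real (Set.Ioi t)) ∧
      (∀ t η, 2 * u0 ≤ t → 0 < η → η ≤ 1 / 2 →
        μ.real (Set.Ioc ((1 - η) * t) t) ≤ C * η * t ^ (-α)) ∧
      (∀ t, u0 ≤ t → ∫ y, trunc t y ^ 2 ∂μ ≤ C * t ^ (2 - α)) := by
  obtain ⟨h0, h2⟩ := hα
  have hK : 0 < K0 := by linarith
  have h2' : 0 < 2 - α := by linarith
  set C1 := 2 * (K0 / α)
  set C2 := K0 * 2 ^ (1 + α)
  set C3 := u0 ^ α + 2 * (K0 / (2 - α))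
  have p1 : 0 < C1 := by positivity
  have p2 : 0 < C2 := by positivity
  have p3 : 0 < C3 := by positivity
  refine ⟨C1 + C2 + C3, k0 / α, by positivity, by positivity, ?_, ?_, ?_, ?_⟩
  · intro t ht
    have ht0 : 0 < t := hu0.trans_le ht
    have hset : {y : ℝ | t < |y|} ⊆ Set.Ioi t ∪ (fun y => -y) ⁻¹' (Set.Ioi t) := by
      intro y hy
      rcases lt_abs.1 (show t < |y| from hy) with h | h
      · exact Or.inl h
      · exact Or.inr h
    have e1 : μ.real (Set.Ioi t) ≤ K0 / α * t ^ (-α) :=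
      ENNReal.toReal_le_of_le_ofReal (by positivity)
        (law_upper μ f α K0 u0 h0 hK hu0 hpdf (fun u hu => (htail u hu).2) t ht)
    have e2 : μ.real ((fun y => -y) ⁻¹' (Set.Ioi t)) = μ.real (Set.Ioi t) := by
      conv_rhs => rw [hs]
      rw [map_measureReal_apply measurable_neg measurableSet_Ioi]
    have e3 := (measureReal_mono hset (measure_ne_top μ _)).trans (measureReal_union_le _ _)
    rw [e2] at e3
    have e4 : 0 < t ^ (-α) := by positivity
    calc _ ≤ C1 * t ^ (-α) := by simp only [C1]; linarith
      _ ≤ _ := by gcongr; linarith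
  · intro t ht
    exact (ENNReal.ofReal_le_iff_le_toReal (measure_ne_top _ _)).1
      (law_lower μ f α k0 u0 h0 hk0 hu0 hpdf (fun u hu => (htail u hu).1) t ht)
  · intro t η ht h1 h3
    have ht0 : 0 < t := by linarith
    have e1 : μ.real (Set.Ioc ((1 - η) * t) t) ≤ C2 * η * t ^ (-α) :=
      ENNReal.toReal_le_of_le_ofReal (by positivity)
        (law_dens μ f α K0 u0 h0 hK hu0 hpdf (fun u hu => (htail u hu).2) t η ht h1 h3)
    refine e1.trans ?_
    gcongr
    linarith
  · intro t ht
    have ht0 : 0 < t := hu0.trans_le ht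
    refine (law_var μ f α K0 u0 h0 h2 hK hu0 hfmeas hs hpdf (fun u hu => (htail u hu).2) t ht).trans ?_
    change C3 * _ ≤ _
    gcongr
    linarith

lemma core_upper {Ω : Type*} [MeasurableSpace Ω] (P : Measure Ω) [IsProbabilityMeasure P] (μ : Measure ℝ)
    [IsProbabilityMeasure μ]
    (X : ℕ → Ω → ℝ) (hmeas : ∀ i, Measurable (X i)) (hindep : iIndepFun X P)
    (hlaw : ∀ i, P.map (X i) = μ) (hmean : ∀ t, ∫ z, trunc t z ∂μ = 0)
    (α C u0 : ℝ) (hC : 0 < C) (hu0 : 0 < u0)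
    (hT : ∀ t, u0 ≤ t → μ.real {y | t < |y|} ≤ C * t ^ (-α))
    (hD : ∀ t η, 2 * u0 ≤ t → 0 < η → η ≤ 1 / 2 →
        μ.real (Set.Ioc ((1 - η) * t) t) ≤ C * η * t ^ (-α))
    (hV : ∀ t, u0 ≤ t → ∫ y, trunc t y ^ 2 ∂μ ≤ C * t ^ (2 - α))
    (n : ℕ) (x c b δ : ℝ) (hx : 0 < x) (hc : c ∈ Set.Ioo (0 : ℝ) 1) (hb : 0 < b)
    (hδ : 0 < δ) (hδ2 : δ ≤ 1 / 2) (hcx : u0 ≤ c * x) (hδx : u0 ≤ δ * x) :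
    P.real ({ω | (∑ i ∈ Finset.range n, X i ω) > x} \ {ω | (∑ i ∈ Finset.range n, X i ω) > x ∧
            ∃ i ∈ Finset.range n, X i ω > x ∧
              |(∑ j ∈ Finset.range n, X j ω) - X i ω| ≤ b * x ∧
              ∀ j ∈ Finset.range n, j ≠ i → |X j ω| ≤ c * x})
      ≤ (n * x ^ (-α)) * (C ^ 2 * (n * x ^ (-α) / c ^ (2 * α))
        + C ^ 2 * (n * x ^ (-α) / (b ^ 2 * c ^ (α - 2)))
        + 2 * C ^ 2 * δ ^ (-(2 * α)) * (n * x ^ (-α)) + C * δ ^ (2 - α) + C * δ) := by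
  obtain ⟨hc0, hc1⟩ := hc
  have hux : 2 * u0 ≤ x := by nlinarith
  have hmabs : ∀ t : ℝ, MeasurableSet {y : ℝ | t < |y|} := fun t =>
    measurableSet_lt measurable_const measurable_id.abs
  have b1 := pairU P μ X hmeas hindep hlaw {y | c * x < |y|} (hmabs _) n
  have b2 := jumpU P μ X hmeas hindep hlaw (c * x) _ (b * x) (by positivity) (by positivity)
    (hmean _) (hV _ hcx) {y | x < |y|} (hmabs _) n
  have b3 := pairU P μ X hmeas hindep hlaw {y | δ * x < |y|} (hmabs _) n
  have b4 := cheb P μ X hmeas hindep hlaw (δ * x) _ x (by positivity) hx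
    (hmean _) (hV _ hδx) (Finset.range n)
  have b5 := singleU P μ X hmeas hlaw (Set.Ioc ((1 - δ) * x) x) measurableSet_Ioc n
  have b6 := jumpU P μ X hmeas hindep hlaw (δ * x) _ (δ * x) (by positivity) (by positivity)
    (hmean _) (hV _ hδx) {y | δ * x < |y|} (hmabs _) n
  set U1 := {ω | ∃ i ∈ Finset.range n, ∃ j ∈ Finset.range n, j ≠ i ∧ X i ω ∈ {y | c * x < |y|} ∧ X j ω ∈ {y | c * x < |y|}} with hU1
  set U2 := {ω | ∃ i ∈ Finset.range n, X i ω ∈ {y | x < |y|} ∧ b * x ≤ |∑ j ∈ (Finset.range n).erase i, trunc (c * x) (X j ω)|} with hU2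
  set U3 := {ω | ∃ i ∈ Finset.range n, ∃ j ∈ Finset.range n, j ≠ i ∧ X i ω ∈ {y | δ * x < |y|} ∧ X j ω ∈ {y | δ * x < |y|}} with hU3
  set U4 := {ω | x ≤ |∑ j ∈ Finset.range n, trunc (δ * x) (X j ω)|} with hU4
  set U5 := {ω | ∃ i ∈ Finset.range n, X i ω ∈ Set.Ioc ((1 - δ) * x) x} with hU5
  set U6 := {ω | ∃ i ∈ Finset.range n, X i ω ∈ {y | δ * x < |y|} ∧ δ * x ≤ |∑ j ∈ (Finset.range n).erase i, trunc (δ * x) (X j ω)|} with hU6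
  have hsub : ({ω | (∑ i ∈ Finset.range n, X i ω) > x} \ {ω | (∑ i ∈ Finset.range n, X i ω) > x ∧
            ∃ i ∈ Finset.range n, X i ω > x ∧
              |(∑ j ∈ Finset.range n, X j ω) - X i ω| ≤ b * x ∧
              ∀ j ∈ Finset.range n, j ≠ i → |X j ω| ≤ c * x}) ⊆ U1 ∪ (U2 ∪ (U3 ∪ (U4 ∪ (U5 ∪ U6)))) := by
    rintro ω ⟨hS, hnA⟩
    have hS' : x < ∑ i ∈ Finset.range n, X i ω := hS
    have hnA' : ∀ i ∈ Finset.range n, x < X i ω → |(∑ j ∈ Finset.range n, X j ω) - X i ω| ≤ b * x →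
        ∃ j ∈ Finset.range n, j ≠ i ∧ c * x < |X j ω| := by
      intro i hi h1 h2
      by_contra hcon
      push Not at hcon
      exact hnA ⟨hS, i, hi, h1, h2, hcon⟩
    have hsum : ∀ i ∈ Finset.range n, ∑ j ∈ (Finset.range n).erase i, X j ω
        = (∑ j ∈ Finset.range n, X j ω) - X i ω := by
      intro i hi
      rw [← Finset.add_sum_erase _ (fun j => X j ω) hi]; ring
    have htr : ∀ (t : ℝ) (J : Finset ℕ), (∀ j ∈ J, |X j ω| ≤ t) →
        ∑ j ∈ J, trunc t (X j ω) = ∑ j ∈ J, X j ω := by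
      intro t J hJ
      exact Finset.sum_congr rfl fun j hj => by simp [trunc, hJ j hj]
    by_cases hbig : ∃ i ∈ Finset.range n, x < X i ω
    · obtain ⟨i, hi, hxi⟩ := hbig
      by_cases hpair : ∃ j ∈ Finset.range n, j ≠ i ∧ c * x < |X j ω|
      · obtain ⟨j, hj, hji, hcj⟩ := hpair
        left
        refine ⟨i, hi, j, hj, hji, ?_, hcj⟩
        change c * x < |X i ω|
        have := le_abs_self (X i ω)
        nlinarith
      · right; left
        refine ⟨i, hi, lt_of_lt_of_le hxi (le_abs_self _), ?_⟩
        rw [htr, hsum i hi]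
        · by_contra hlt
          push Not at hlt
          exact hpair (hnA' i hi hxi hlt.le)
        · intro j hj
          by_contra hlt
          push Not at hlt
          exact hpair ⟨j, Finset.mem_of_mem_erase hj, Finset.ne_of_mem_erase hj, hlt⟩
    · push Not at hbig
      right; right
      by_cases hone : ∃ i ∈ Finset.range n, δ * x < |X i ω|
      · obtain ⟨i, hi, hdi⟩ := hone
        by_cases hpair : ∃ j ∈ Finset.range n, j ≠ i ∧ δ * x < |X j ω|
        · obtain ⟨j, hj, hji, hcj⟩ := hpair
          left
          exact ⟨i, hi, j, hj, hji, hdi, hcj⟩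
        · right; right
          by_cases hcl : (1 - δ) * x < X i ω
          · left
            exact ⟨i, hi, hcl, hbig i hi⟩
          · right
            refine ⟨i, hi, hdi, ?_⟩
            rw [htr, hsum i hi]
            · push Not at hcl
              refine le_trans ?_ (le_abs_self _)
              linarith
            · intro j hj
              by_contra hlt
              push Not at hlt
              exact hpair ⟨j, Finset.mem_of_mem_erase hj, Finset.ne_of_mem_erase hj, hlt⟩
      · push Not at hone
        right; left
        change x ≤ _
        rw [htr _ _ hone]
        exact hS'.le.trans (le_abs_self _)
  have hle := measureReal_mono (μ := P) hsub (measure_ne_top P _)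
  have u1 := measureReal_union_le (μ := P) U1 (U2 ∪ (U3 ∪ (U4 ∪ (U5 ∪ U6))))
  have u2 := measureReal_union_le (μ := P) U2 (U3 ∪ (U4 ∪ (U5 ∪ U6)))
  have u3 := measureReal_union_le (μ := P) U3 (U4 ∪ (U5 ∪ U6))
  have u4 := measureReal_union_le (μ := P) U4 (U5 ∪ U6)
  have u5 := measureReal_union_le (μ := P) U5 U6
  have t1 := hT _ hcx
  have t2 := hT x (by linarith)
  have t3 := hT _ hδx
  have t5 := hD x δ hux hδ hδ2
  have m0 : ∀ B, 0 ≤ μ.real B := fun B => measureReal_nonneg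
  have hn0 : (0 : ℝ) ≤ n := Nat.cast_nonneg n
  have q1 : P.real U1 ≤ (n * (C * (c * x) ^ (-α))) ^ 2 := b1.trans (by gcongr)
  have q2 : P.real U2 ≤ n * (C * x ^ (-α) * (n * (C * (c * x) ^ (2 - α)) / (b * x) ^ 2)) :=
    b2.trans (by gcongr)
  have q3 : P.real U3 ≤ (n * (C * (δ * x) ^ (-α))) ^ 2 := b3.trans (by gcongr)
  have q4 : P.real U4 ≤ n * (C * (δ * x) ^ (2 - α)) / x ^ 2 := by simpa using b4
  have q5 : P.real U5 ≤ n * (C * δ * x ^ (-α)) := b5.trans (by gcongr)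
  have q6 : P.real U6 ≤ n * (C * (δ * x) ^ (-α) * (n * (C * (δ * x) ^ (2 - α)) / (δ * x) ^ 2)) :=
    b6.trans (by gcongr)
  have r1 : ∀ y : ℝ, 0 < y → y ^ (-α) = (y ^ α)⁻¹ := fun y hy => Real.rpow_neg hy.le α
  have r2 : ∀ y : ℝ, 0 < y → y ^ (2 - α) = y ^ 2 / y ^ α := fun y hy => by
    rw [Real.rpow_sub hy]; norm_num
  have r3 : ∀ y : ℝ, 0 < y → y ^ (α - 2) = y ^ α / y ^ 2 := fun y hy => by
    rw [Real.rpow_sub hy]; norm_num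
  have r4 : ∀ y : ℝ, 0 < y → y ^ (2 * α) = (y ^ α) ^ 2 := fun y hy => by
    rw [mul_comm, Real.rpow_mul hy.le]; norm_num
  have r5 : ∀ y : ℝ, 0 < y → y ^ (-(2 * α)) = ((y ^ α) ^ 2)⁻¹ := fun y hy => by
    rw [Real.rpow_neg hy.le, r4 y hy]
  refine (hle.trans (?_ : _ ≤ (n * (C * (c * x) ^ (-α))) ^ 2
    + n * (C * x ^ (-α) * (n * (C * (c * x) ^ (2 - α)) / (b * x) ^ 2))
    + (n * (C * (δ * x) ^ (-α))) ^ 2 + n * (C * (δ * x) ^ (2 - α)) / x ^ 2 + n * (C * δ * x ^ (-α))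
    + n * (C * (δ * x) ^ (-α) * (n * (C * (δ * x) ^ (2 - α)) / (δ * x) ^ 2)))).trans (le_of_eq ?_)
  · linarith
  · have hcx0 : 0 < c * x := by positivity
    have hdx0 : 0 < δ * x := by positivity
    rw [r1 _ hcx0, r1 _ hdx0, r2 _ hcx0, r2 _ hdx0, r1 x hx, r2 δ hδ, r3 c hc0, r4 c hc0, r5 δ hδ,
      Real.mul_rpow hc0.le hx.le, Real.mul_rpow hδ.le hx.le]
    have z1 : 0 < c ^ α := by positivity
    have z2 : 0 < x ^ α := by positivity
    have z3 : 0 < δ ^ α := by positivity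
    field_simp
    ring

lemma core_lower {Ω : Type*} [MeasurableSpace Ω] (P : Measure Ω) [IsProbabilityMeasure P] (μ : Measure ℝ)
    [IsProbabilityMeasure μ]
    (X : ℕ → Ω → ℝ) (hmeas : ∀ i, Measurable (X i)) (hindep : iIndepFun X P)
    (hlaw : ∀ i, P.map (X i) = μ) (hmean : ∀ t, ∫ z, trunc t z ∂μ = 0)
    (α C κ u0 : ℝ) (hC : 0 < C) (hu0 : 0 < u0)
    (hT : ∀ t, u0 ≤ t → μ.real {y | t < |y|} ≤ C * t ^ (-α))
    (hL : ∀ t, u0 ≤ t → κ * t ^ (-α) ≤ μ.real (Set.Ioi t))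
    (hV : ∀ t, u0 ≤ t → ∫ y, trunc t y ^ 2 ∂μ ≤ C * t ^ (2 - α))
    (n : ℕ) (x : ℝ) (hx : 0 < x) (hux : u0 ≤ x) (hp : C * (n * x ^ (-α)) ≤ 1) :
    (n * x ^ (-α)) * (κ * 2 ^ (-α) / 2 - 2 * C ^ 2 * (n * x ^ (-α)))
      ≤ P.real {ω | (∑ i ∈ Finset.range n, X i ω) > x} := by
  have hmabs : ∀ t : ℝ, MeasurableSet {y : ℝ | t < |y|} := fun t =>
    measurableSet_lt measurable_const measurable_id.abs
  have hn0 : (0 : ℝ) ≤ n := Nat.cast_nonneg n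
  have t1 := hT x hux
  have hmm : μ.real (Set.Ioi (2 * x)) ≤ μ.real {y | x < |y|} := by
    refine measureReal_mono (fun y hy => ?_) (measure_ne_top _ _)
    have h1 : 2 * x < y := hy
    have := le_abs_self y
    change x < |y|
    linarith
  have b1 := pairU P μ X hmeas hindep hlaw {y | x < |y|} (hmabs _) n
  have b2 := jumpU P μ X hmeas hindep hlaw x _ x hx.le hx
    (hmean _) (hV _ hux) {y | x < |y|} (hmabs _) n
  have b3 := singleL P μ X hmeas hindep hlaw (Set.Ioi (2 * x)) measurableSet_Ioi n (by
    calc n * μ.real (Set.Ioi (2 * x)) ≤ n * (C * x ^ (-α)) := by gcongr; linarith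
      _ ≤ 1 := by linarith)
  set U1 := {ω | ∃ i ∈ Finset.range n, ∃ j ∈ Finset.range n, j ≠ i ∧ X i ω ∈ {y | x < |y|} ∧ X j ω ∈ {y | x < |y|}} with hU1
  set U2 := {ω | ∃ i ∈ Finset.range n, X i ω ∈ {y | x < |y|} ∧ x ≤ |∑ j ∈ (Finset.range n).erase i, trunc x (X j ω)|} with hU2
  set S := {ω | (∑ i ∈ Finset.range n, X i ω) > x} with hS
  have hsub : {ω | ∃ i ∈ Finset.range n, X i ω ∈ Set.Ioi (2 * x)} ⊆ S ∪ (U1 ∪ U2) := by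
    rintro ω ⟨i, hi, h2⟩
    have h2' : 2 * x < X i ω := h2
    have hab : x < |X i ω| := by have := le_abs_self (X i ω); linarith
    by_cases hpair : ∃ j ∈ Finset.range n, j ≠ i ∧ x < |X j ω|
    · obtain ⟨j, hj, hji, hcj⟩ := hpair
      right; left
      exact ⟨i, hi, j, hj, hji, hab, hcj⟩
    · by_cases hu : x ≤ |∑ j ∈ (Finset.range n).erase i, trunc x (X j ω)|
      · right; right
        exact ⟨i, hi, hab, hu⟩
      · left
        have htr : ∑ j ∈ (Finset.range n).erase i, trunc x (X j ω) = ∑ j ∈ (Finset.range n).erase i, X j ω := by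
          refine Finset.sum_congr rfl fun j hj => ?_
          have : |X j ω| ≤ x := by
            by_contra hlt
            push Not at hlt
            exact hpair ⟨j, Finset.mem_of_mem_erase hj, Finset.ne_of_mem_erase hj, hlt⟩
          simp [trunc, this]
        rw [htr] at hu
        push Not at hu
        change x < ∑ i ∈ Finset.range n, X i ω
        rw [← Finset.add_sum_erase _ (fun j => X j ω) hi]
        have := neg_lt_of_abs_lt hu
        linarith
  have hle := measureReal_mono (μ := P) hsub (measure_ne_top P _)
  have u1 := measureReal_union_le (μ := P) S (U1 ∪ U2)
  have u2 := measureReal_union_le (μ := P) U1 U2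
  have m0 : ∀ B, 0 ≤ μ.real B := fun B => measureReal_nonneg
  have q1 : P.real U1 ≤ (n * (C * x ^ (-α))) ^ 2 := b1.trans (by gcongr)
  have q2 : P.real U2 ≤ n * (C * x ^ (-α) * (n * (C * x ^ (2 - α)) / x ^ 2)) :=
    b2.trans (by gcongr)
  have q3 : n * (κ * (2 * x) ^ (-α)) / 2 ≤ P.real {ω | ∃ i ∈ Finset.range n, X i ω ∈ Set.Ioi (2 * x)} := by
    refine le_trans ?_ b3
    gcongr
    exact hL _ (by linarith)
  have r2 : x ^ (2 - α) = x ^ 2 * x ^ (-α) := by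
    rw [Real.rpow_sub hx, Real.rpow_neg hx.le]; norm_num; rfl
  rw [Real.mul_rpow (by norm_num) hx.le] at q3
  rw [r2] at q2
  have q2' : n * (C * x ^ (-α) * (n * (C * (x ^ 2 * x ^ (-α))) / x ^ 2)) = C ^ 2 * (n * x ^ (-α)) ^ 2 := by
    field_simp
  rw [q2'] at q2
  nlinarith


/-- Theorem 1 of the paper: large deviations of sums with power-like tails are
mainly due to just one summand. -/
theorem large_deviation_one_summand
    {Ω : Type*} [MeasureSpace Ω] [IsProbabilityMeasure (ℙ : Measure Ω)]
    (α : ℝ) (hα : α ∈ Set.Ioo (0 : ℝ) 2)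
    (X : ℕ → Ω → ℝ) (hmeas : ∀ i, Measurable (X i))
    (hindep : iIndepFun X ℙ)
    (hident : ∀ i, IdentDistrib (X i) (X 0) ℙ ℙ)
    (hsymm : Measure.map (X 0) ℙ = Measure.map (fun ω => -(X 0 ω)) ℙ)
    (f : ℝ → ℝ) (hf0 : ∀ u, 0 ≤ f u) (hfmeas : Measurable f)
    (hpdf : Measure.map (X 0) ℙ = (volume : Measure ℝ).withDensity (fun u => ENNReal.ofReal (f u)))
    (k0 K0 u0 : ℝ) (hk0 : 0 < k0) (hK0 : k0 ≤ K0) (hu0 : 0 < u0)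
    (htail : ∀ u, u0 ≤ u → k0 * u ^ (-1 - α) ≤ f u ∧ f u ≤ K0 * u ^ (-1 - α))
    (n : ℕ → ℕ) (hn : ∀ k, 0 < n k)
    (x : ℕ → ℝ) (hx : ∀ k, 0 < x k)
    (c : ℕ → ℝ) (hc : ∀ k, c k ∈ Set.Ioo (0 : ℝ) 1)
    (b : ℕ → ℝ) (hb : ∀ k, b k ∈ Set.Ioo (0 : ℝ) 1)
    (hLD : Tendsto (fun k => (n k : ℝ) / x k ^ α) atTop (nhds 0))
    (hcc : Tendsto (fun k => (n k : ℝ) * x k ^ (-α) / c k ^ (2 * α)) atTop (nhds 0))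
    (hbb : Tendsto (fun k => (n k : ℝ) * x k ^ (-α) / (b k ^ 2 * c k ^ (α - 2))) atTop (nhds 0)) :
    Tendsto (fun k =>
        (ℙ {ω | (∑ i ∈ Finset.range (n k), X i ω) > x k}).toReal /
        (ℙ {ω | (∑ i ∈ Finset.range (n k), X i ω) > x k ∧
            ∃ i ∈ Finset.range (n k), X i ω > x k ∧
              |(∑ j ∈ Finset.range (n k), X j ω) - X i ω| ≤ b k * x k ∧
              ∀ j ∈ Finset.range (n k), j ≠ i → |X j ω| ≤ c k * x k}).toReal)
      atTop (nhds 1) := by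
  classical
  obtain ⟨h0, h2⟩ := hα
  set μ : Measure ℝ := Measure.map (X 0) (ℙ : Measure Ω) with hμ
  haveI : IsProbabilityMeasure μ := Measure.isProbabilityMeasure_map (hmeas 0).aemeasurable
  have hlaw : ∀ i, Measure.map (X i) (ℙ : Measure Ω) = μ := fun i => (hident i).map_eq
  have hs : μ = μ.map (fun y => -y) := by
    rw [hμ, Measure.map_map measurable_neg (hmeas 0)]
    exact hsymm
  obtain ⟨C, κ, hC, hκ, hT, hL, hD, hV⟩ :=
    law_consts μ α ⟨h0, h2⟩ hs f hfmeas hpdf k0 K0 u0 hk0 hK0 hu0 htail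
  have hmean := law_mean μ hs
  set P : Measure Ω := ℙ
  set E : ℕ → Set Ω := fun k => {ω | (∑ i ∈ Finset.range (n k), X i ω) > x k} with hE
  set A : ℕ → Set Ω := fun k => {ω | (∑ i ∈ Finset.range (n k), X i ω) > x k ∧
            ∃ i ∈ Finset.range (n k), X i ω > x k ∧
              |(∑ j ∈ Finset.range (n k), X j ω) - X i ω| ≤ b k * x k ∧
              ∀ j ∈ Finset.range (n k), j ≠ i → |X j ω| ≤ c k * x k} with hA
  change Tendsto (fun k => P.real (E k) / P.real (A k)) atTop (nhds 1)
  set p : ℕ → ℝ := fun k => (n k : ℝ) * x k ^ (-α) with hp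
  have hp0 : ∀ k, 0 < p k := fun k => by
    have h1 : (0 : ℝ) < n k := Nat.cast_pos.2 (hn k)
    have h3 := hx k
    simp only [hp]; positivity
  have hpt : Tendsto p atTop (nhds 0) := by
    refine hLD.congr fun k => ?_
    simp only [hp]
    rw [Real.rpow_neg (hx k).le, div_eq_mul_inv]
  -- largeness of `t` from smallness of `t ^ (-α)`
  have hlarge : ∀ y t : ℝ, 0 < y → 0 < t → t ^ (-α) < y ^ (-α) → y ≤ t := by
    intro y t hy ht h
    by_contra hlt
    push Not at hlt
    have := Real.rpow_le_rpow_of_nonpos ht hlt.le (by linarith : -α ≤ 0)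
    linarith
  have hxbig : ∀ y : ℝ, 0 < y → ∀ᶠ k in atTop, y ≤ x k := by
    intro y hy
    have hyp : 0 < y ^ (-α) := by positivity
    filter_upwards [hpt.eventually (gt_mem_nhds hyp)] with k hk
    refine hlarge y (x k) hy (hx k) (lt_of_le_of_lt ?_ hk)
    have h1 : (1 : ℝ) ≤ n k := by exact_mod_cast hn k
    have h3 : 0 < x k ^ (-α) := Real.rpow_pos_of_pos (hx k) _
    simp only [hp]
    nlinarith
  have hcbig : ∀ᶠ k in atTop, u0 ≤ c k * x k := by
    have hyp : 0 < u0 ^ (-α) := by positivity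
    filter_upwards [hcc.eventually (gt_mem_nhds hyp)] with k hk
    have hc0 := (hc k).1
    have hc1 := (hc k).2
    have hxk := hx k
    have h5 : u0 ≤ (c k) ^ 2 * x k := by
      refine hlarge u0 _ hu0 (by positivity) (lt_of_le_of_lt ?_ hk)
      have h1 : (1 : ℝ) ≤ n k := by exact_mod_cast hn k
      have h3 : 0 < x k ^ (-α) := Real.rpow_pos_of_pos (hx k) _
      have h4 : 0 < c k ^ (2 * α) := Real.rpow_pos_of_pos hc0 _
      have e : (c k ^ 2 * x k) ^ (-α) = x k ^ (-α) / c k ^ (2 * α) := by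
        rw [Real.mul_rpow (by positivity) hxk.le, Real.rpow_neg (by positivity),
          ← Real.rpow_natCast (c k) 2, ← Real.rpow_mul hc0.le]
        push_cast
        field_simp
      rw [e]
      gcongr
      nlinarith
    have h6 : (c k) ^ 2 * x k ≤ c k * x k := by
      gcongr
      nlinarith
    linarith
  set κ' : ℝ := κ * 2 ^ (-α) / 2 with hκ'
  have hκ'0 : 0 < κ' := by positivity
  have hlow : ∀ᶠ k in atTop, p k * (κ' / 2) ≤ P.real (E k) := by
    have h1 : ∀ᶠ k in atTop, p k < 1 / C := hpt.eventually (gt_mem_nhds (by positivity))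
    have h3 : ∀ᶠ k in atTop, p k < κ' / (4 * C ^ 2) := hpt.eventually (gt_mem_nhds (by positivity))
    filter_upwards [h1, h3, hxbig u0 hu0] with k k1 k3 kx
    rw [lt_div_iff₀ (by positivity)] at k1 k3
    have := core_lower P μ X hmeas hindep hlaw hmean α C κ u0 hC hu0 hT hL hV (n k) (x k) (hx k) kx
      (by change C * p k ≤ 1; linarith)
    refine le_trans ?_ this
    change _ ≤ p k * (κ' - 2 * C ^ 2 * p k)
    have := hp0 k
    gcongr
    linarith
  have hdiff : ∀ ε : ℝ, 0 < ε → ∀ᶠ k in atTop, P.real (E k \ A k) ≤ p k * ε := by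
    intro ε hε
    have hlim : Tendsto (fun δ : ℝ => C * δ ^ (2 - α) + C * δ) (nhds 0) (nhds 0) := by
      have hcont : ContinuousAt (fun δ : ℝ => C * δ ^ (2 - α) + C * δ) 0 := by
        have : ContinuousAt (fun δ : ℝ => δ ^ (2 - α)) 0 :=
          Real.continuousAt_rpow_const 0 (2 - α) (Or.inr (by linarith))
        fun_prop
      have h := hcont.tendsto
      simpa [Real.zero_rpow (by linarith : 2 - α ≠ 0)] using h
    have hev : ∀ᶠ δ in nhdsWithin (0 : ℝ) (Set.Ioi 0), C * δ ^ (2 - α) + C * δ < ε / 2 ∧ δ < 1 / 2 ∧ 0 < δ := by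
      have e1 : ∀ᶠ δ in nhdsWithin (0 : ℝ) (Set.Ioi 0), C * δ ^ (2 - α) + C * δ < ε / 2 :=
        (hlim.eventually (gt_mem_nhds (by positivity))).filter_mono nhdsWithin_le_nhds
      have e2 : ∀ᶠ δ in nhdsWithin (0 : ℝ) (Set.Ioi 0), δ < 1 / 2 :=
        (gt_mem_nhds (by norm_num : (0 : ℝ) < 1 / 2)).filter_mono nhdsWithin_le_nhds
      filter_upwards [e1, e2, self_mem_nhdsWithin] with δ a1 a2 a3
      exact ⟨a1, a2, a3⟩
    obtain ⟨δ, hδ1, hδ2, hδ0⟩ := hev.exists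
    have hR : Tendsto (fun k => C ^ 2 * ((n k : ℝ) * x k ^ (-α) / c k ^ (2 * α))
        + C ^ 2 * ((n k : ℝ) * x k ^ (-α) / (b k ^ 2 * c k ^ (α - 2)))
        + 2 * C ^ 2 * δ ^ (-(2 * α)) * p k) atTop (nhds 0) := by
      have := ((hcc.const_mul (C ^ 2)).add (hbb.const_mul (C ^ 2))).add
        (hpt.const_mul (2 * C ^ 2 * δ ^ (-(2 * α))))
      simpa using this
    filter_upwards [hR.eventually (gt_mem_nhds (by positivity : 0 < ε / 2)), hcbig,
      hxbig (u0 / δ) (by positivity)] with k k1 k2 k3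
    have hcore := core_upper P μ X hmeas hindep hlaw hmean α C u0 hC hu0 hT hD hV (n k) (x k) (c k) (b k) δ
      (hx k) (hc k) (hb k).1 hδ0 hδ2.le k2 (by rw [div_le_iff₀ hδ0] at k3; linarith)
    refine hcore.trans ?_
    have := hp0 k
    change p k * _ ≤ p k * ε
    gcongr
    simp only [hp] at k1
    linarith
  have hq : Tendsto (fun k => P.real (A k) / P.real (E k)) atTop (nhds 1) := by
    rw [Metric.tendsto_nhds]
    intro ε hε
    filter_upwards [hlow, hdiff (κ' / 2 * (ε / 2)) (by positivity)] with k k1 k2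
    have hpk := hp0 k
    have ha : 0 < P.real (E k) := lt_of_lt_of_le (by positivity) k1
    have hAE : A k ⊆ E k := fun ω hω => hω.1
    have m1 : P.real (A k) ≤ P.real (E k) := measureReal_mono hAE (measure_ne_top _ _)
    have m2 : P.real (E k) ≤ P.real (A k) + P.real (E k \ A k) := by
      refine le_trans (measureReal_mono ?_ (measure_ne_top _ _)) (measureReal_union_le _ _)
      intro ω hω
      by_cases h : ω ∈ A k
      · exact Or.inl h
      · exact Or.inr ⟨hω, h⟩
    have m3 : P.real (E k \ A k) ≤ ε / 2 * P.real (E k) := by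
      refine k2.trans ?_
      nlinarith
    rw [Real.dist_eq, abs_sub_comm, abs_of_nonneg]
    · rw [sub_lt_comm, lt_div_iff₀ ha]
      nlinarith
    · rw [sub_nonneg, div_le_one ha]; exact m1
  have := hq.inv₀ one_ne_zero
  simpa [inv_div] using this
end

section
/- Let α ∈ (0,2). Let X_1, X_2, … be independent identically distributed real random variables whose common distribution is symmetric about 0 and has a probability density function f satisfying f(u) ≍ u^{-1-α} as u → ∞. For n ∈ ℕ let S_n := X_1 + … + X_n. Then for any sequences (n_k) of positive integers and (x_k) of positive reals with n_k / x_k^α → 0, one has limsup_k [ n_k · P(X_1 > x_k) / P(S_{n_k} > x_k) ] < ∞; moreover n_k · P(X_1 > x_k) ≍ n_k x_k^{-α} as k → ∞. -/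
open MeasureTheory ProbabilityTheory Filter

/-- Partial sums of independent symmetric variables are symmetric. -/
theorem sum_symm_aux {Ω : Type*} [MeasureSpace Ω] [IsProbabilityMeasure (ℙ : Measure Ω)]
    (X : ℕ → Ω → ℝ) (hmeas : ∀ i, Measurable (X i))
    (hindep : iIndepFun X ℙ)
    (hsymm : ∀ i, Measure.map (X i) ℙ = Measure.map (-(X i)) ℙ) (s : Finset ℕ) :
    Measure.map (∑ i ∈ s, X i) (ℙ : Measure Ω) = Measure.map (-(∑ i ∈ s, X i)) ℙ := by
  induction s using Finset.induction_on with
  | empty => simp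
  | insert a s ha ih =>
    have hT : Measurable (∑ i ∈ s, X i) := by
      rw [show (∑ i ∈ s, X i) = fun ω => ∑ i ∈ s, X i ω from by ext; simp]
      exact Finset.measurable_sum _ (fun i _ => hmeas i)
    have hI := hindep.indepFun_finsetSum_of_notMem hmeas ha
    have hI' : IndepFun (-(∑ i ∈ s, X i)) (-(X a)) ℙ :=
      hI.comp (φ := fun y : ℝ => -y) (ψ := fun y : ℝ => -y) measurable_neg measurable_neg
    rw [Finset.sum_insert ha, add_comm, neg_add, hI.map_add_eq_map_conv_map hT (hmeas a),
      hI'.map_add_eq_map_conv_map hT.neg (hmeas a).neg, ← ih, ← hsymm a]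

/-- A symmetric variable is nonnegative with probability at least one half. -/
theorem half_le_aux {Ω : Type*} [MeasureSpace Ω] [IsProbabilityMeasure (ℙ : Measure Ω)]
    (T : Ω → ℝ) (hT : Measurable T)
    (hs : Measure.map T (ℙ : Measure Ω) = Measure.map (-T) ℙ) :
    1 / 2 ≤ (ℙ : Measure Ω).real (T ⁻¹' Set.Ici 0) := by
  have h1 : (ℙ : Measure Ω).real (T ⁻¹' Set.Ici 0) = (ℙ : Measure Ω).real ((-T) ⁻¹' Set.Ici 0) := by
    rw [← map_measureReal_apply hT measurableSet_Ici, hs,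
      map_measureReal_apply hT.neg measurableSet_Ici]
  have h2 : (Set.univ : Set Ω) ⊆ T ⁻¹' Set.Ici 0 ∪ (-T) ⁻¹' Set.Ici 0 := by
    intro ω _
    rcases le_total 0 (T ω) with h | h
    · left; exact h
    · right; simpa using h
  have h3 := measureReal_mono (μ := (ℙ : Measure Ω)) h2
  have h4 := measureReal_union_le (μ := (ℙ : Measure Ω)) (T ⁻¹' Set.Ici 0) ((-T) ⁻¹' Set.Ici 0)
  rw [probReal_univ] at h3
  linarith

theorem indep_real_aux {Ω : Type*} [MeasureSpace Ω] [IsProbabilityMeasure (ℙ : Measure Ω)]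
    {f g : Ω → ℝ} (h : IndepFun f g ℙ) {s t : Set ℝ} (hs : MeasurableSet s)
    (ht : MeasurableSet t) :
    (ℙ : Measure Ω).real (f ⁻¹' s ∩ g ⁻¹' t) =
      (ℙ : Measure Ω).real (f ⁻¹' s) * (ℙ : Measure Ω).real (g ⁻¹' t) := by
  simp only [measureReal_def, h.measure_inter_preimage_eq_mul s t hs ht, ENNReal.toReal_mul]

/-- One-big-jump lower bound. -/
theorem sum_lower_aux {Ω : Type*} [MeasureSpace Ω] [IsProbabilityMeasure (ℙ : Measure Ω)]
    (X : ℕ → Ω → ℝ) (hmeas : ∀ i, Measurable (X i))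
    (hindep : iIndepFun X ℙ)
    (hident : ∀ i, IdentDistrib (X i) (X 0) ℙ ℙ)
    (hsymm : Measure.map (X 0) ℙ = Measure.map (fun ω => -(X 0 ω)) ℙ)
    (n : ℕ) (x p : ℝ) (hp : p = (ℙ : Measure Ω).real {ω | X 0 ω > x}) :
    n * (p * (1 / 2) - n * (p * p)) ≤
      (ℙ : Measure Ω).real {ω | (∑ i ∈ Finset.range n, X i ω) > x} := by
  have hp0 : 0 ≤ p := hp ▸ measureReal_nonneg
  have hpi : ∀ i, (ℙ : Measure Ω).real (X i ⁻¹' Set.Ioi x) = p := by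
    intro i
    rw [hp, measureReal_def, (hident i).measure_mem_eq measurableSet_Ioi]
    rfl
  have hsi : ∀ i, Measure.map (X i) (ℙ : Measure Ω) = Measure.map (-(X i)) ℙ := by
    intro i
    rw [(hident i).map_eq, hsymm]
    exact ((hident i).comp (u := fun y : ℝ => -y) measurable_neg).map_eq.symm
  let T : ℕ → Ω → ℝ := fun i => ∑ j ∈ (Finset.range n).erase i, X j
  have hT : ∀ i, Measurable (T i) := by
    intro i
    rw [show T i = fun ω => ∑ j ∈ (Finset.range n).erase i, X j ω from by ext; simp [T]]
    exact Finset.measurable_sum _ (fun j _ => hmeas j)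
  let U : ℕ → Set Ω := fun i => ⋃ j ∈ (Finset.range n).erase i,
    X i ⁻¹' Set.Ioi x ∩ X j ⁻¹' Set.Ioi x
  let B : ℕ → Set Ω := fun i => (T i ⁻¹' Set.Ici 0 ∩ X i ⁻¹' Set.Ioi x) \ U i
  have hBm : ∀ i, MeasurableSet (B i) := by
    intro i
    refine (((hT i) measurableSet_Ici).inter ((hmeas i) measurableSet_Ioi)).diff ?_
    exact Finset.measurableSet_biUnion _
      (fun j _ => ((hmeas i) measurableSet_Ioi).inter ((hmeas j) measurableSet_Ioi))
  have hB : ∀ i ∈ Finset.range n, p * (1 / 2) - n * (p * p) ≤ (ℙ : Measure Ω).real (B i) := by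
    intro i hi
    have h1 : p * (1 / 2) ≤ (ℙ : Measure Ω).real (T i ⁻¹' Set.Ici 0 ∩ X i ⁻¹' Set.Ioi x) := by
      rw [indep_real_aux (hindep.indepFun_finsetSum_of_notMem hmeas (Finset.notMem_erase i _))
        measurableSet_Ici measurableSet_Ioi, hpi, mul_comm]
      exact mul_le_mul_of_nonneg_right
        (half_le_aux _ (hT i) (sum_symm_aux X hmeas hindep hsi _)) hp0
    have h2 : (ℙ : Measure Ω).real (U i) ≤ n * (p * p) := by
      refine (measureReal_biUnion_finset_le _ _).trans ?_
      have : ∀ j ∈ (Finset.range n).erase i,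
          (ℙ : Measure Ω).real (X i ⁻¹' Set.Ioi x ∩ X j ⁻¹' Set.Ioi x) = p * p := by
        intro j hj
        rw [indep_real_aux (hindep.indepFun (Finset.ne_of_mem_erase hj).symm)
          measurableSet_Ioi measurableSet_Ioi, hpi, hpi]
      rw [Finset.sum_congr rfl this, Finset.sum_const, nsmul_eq_mul]
      have hc : ((Finset.range n).erase i).card ≤ n := by
        simpa using Finset.card_erase_le (s := Finset.range n) (a := i)
      exact mul_le_mul_of_nonneg_right (by exact_mod_cast hc) (mul_nonneg hp0 hp0)
    have h3 := le_measureReal_sdiff (μ := (ℙ : Measure Ω))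
      (s₁ := T i ⁻¹' Set.Ici 0 ∩ X i ⁻¹' Set.Ioi x) (s₂ := U i) (measure_ne_top _ _)
    change _ ≤ (ℙ : Measure Ω).real (_ \ _)
    linarith
  have hdisj : ((Finset.range n : Finset ℕ) : Set ℕ).PairwiseDisjoint B := by
    intro i hi j hj hij
    refine Set.disjoint_left.mpr ?_
    rintro ω ⟨⟨_, h1⟩, h2⟩ ⟨⟨_, h3⟩, _⟩
    exact h2 (Set.mem_biUnion (Finset.mem_erase.mpr ⟨hij.symm, hj⟩) ⟨h1, h3⟩)
  have hsub : (⋃ i ∈ Finset.range n, B i) ⊆ {ω | (∑ i ∈ Finset.range n, X i ω) > x} := by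
    intro ω hω
    simp only [Set.mem_iUnion] at hω
    obtain ⟨i, hi, ⟨h1, h2⟩, _⟩ := hω
    have h1' : 0 ≤ ∑ j ∈ (Finset.range n).erase i, X j ω := by
      have : 0 ≤ T i ω := h1
      simpa [T, Finset.sum_apply] using this
    have h2' : x < X i ω := h2
    have := Finset.add_sum_erase (Finset.range n) (fun j => X j ω) hi
    change x < _
    linarith
  calc n * (p * (1 / 2) - n * (p * p))
      = ∑ i ∈ Finset.range n, (p * (1 / 2) - n * (p * p)) := by
        rw [Finset.sum_const, nsmul_eq_mul, Finset.card_range]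
    _ ≤ ∑ i ∈ Finset.range n, (ℙ : Measure Ω).real (B i) := Finset.sum_le_sum hB
    _ = (ℙ : Measure Ω).real (⋃ i ∈ Finset.range n, B i) :=
        (measureReal_biUnion_finset hdisj (fun i _ => hBm i)).symm
    _ ≤ _ := measureReal_mono hsub

theorem lint_aux (α : ℝ) (hα : 0 < α) (k x : ℝ) (hk : 0 < k) (hx : 0 < x) :
    ∫⁻ u in Set.Ioi x, ENNReal.ofReal (k * u ^ (-1 - α)) =
      ENNReal.ofReal (k / α * x ^ (-α)) := by
  rw [← ofReal_integral_eq_lintegral_ofReal]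
  · rw [integral_const_mul, integral_Ioi_rpow_of_lt (by linarith) hx]
    congr 1
    rw [show -1 - α + 1 = -α by ring]
    field_simp
  · exact (integrableOn_Ioi_rpow_of_lt (by linarith) hx).const_mul k
  · filter_upwards [ae_restrict_mem measurableSet_Ioi] with u hu
    have : 0 < u := hx.trans hu
    simp only [Pi.zero_apply]
    positivity

theorem tail_aux {Ω : Type*} [MeasureSpace Ω] [IsProbabilityMeasure (ℙ : Measure Ω)]
    (α : ℝ) (hα : 0 < α) (Y : Ω → ℝ) (hY : Measurable Y)
    (f : ℝ → ℝ)
    (hpdf : Measure.map Y ℙ = (volume : Measure ℝ).withDensity (fun u => ENNReal.ofReal (f u)))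
    (k0 K0 u0 : ℝ) (hk0 : 0 < k0) (hK0 : k0 ≤ K0) (hu0 : 0 < u0)
    (htail : ∀ u, u0 ≤ u → k0 * u ^ (-1 - α) ≤ f u ∧ f u ≤ K0 * u ^ (-1 - α))
    (x : ℝ) (hx : u0 ≤ x) :
    k0 / α * x ^ (-α) ≤ ((ℙ : Measure Ω) {ω | Y ω > x}).toReal ∧
      ((ℙ : Measure Ω) {ω | Y ω > x}).toReal ≤ K0 / α * x ^ (-α) := by
  have hx0 : 0 < x := hu0.trans_le hx
  have hK : 0 < K0 := hk0.trans_le hK0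
  have h : (ℙ : Measure Ω) {ω | Y ω > x} = ∫⁻ u in Set.Ioi x, ENNReal.ofReal (f u) := by
    rw [← withDensity_apply _ measurableSet_Ioi, ← hpdf, Measure.map_apply hY measurableSet_Ioi]
    rfl
  have hlo : ENNReal.ofReal (k0 / α * x ^ (-α)) ≤ (ℙ : Measure Ω) {ω | Y ω > x} := by
    rw [h, ← lint_aux α hα k0 x hk0 hx0]
    exact setLIntegral_mono' measurableSet_Ioi
      (fun u hu => ENNReal.ofReal_le_ofReal (htail u (hx.trans (le_of_lt hu))).1)
  have hhi : (ℙ : Measure Ω) {ω | Y ω > x} ≤ ENNReal.ofReal (K0 / α * x ^ (-α)) := by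
    rw [h, ← lint_aux α hα K0 x hK hx0]
    exact setLIntegral_mono' measurableSet_Ioi
      (fun u hu => ENNReal.ofReal_le_ofReal (htail u (hx.trans (le_of_lt hu))).2)
  exact ⟨(ENNReal.ofReal_le_iff_le_toReal (measure_ne_top _ _)).mp hlo,
    ENNReal.toReal_le_of_le_ofReal (by positivity) hhi⟩

theorem lower_bound_via_max_summand
    {Ω : Type*} [MeasureSpace Ω] [IsProbabilityMeasure (ℙ : Measure Ω)]
    (α : ℝ) (hα : α ∈ Set.Ioo (0 : ℝ) 2)
    (X : ℕ → Ω → ℝ) (hmeas : ∀ i, Measurable (X i))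
    (hindep : iIndepFun X ℙ)
    (hident : ∀ i, IdentDistrib (X i) (X 0) ℙ ℙ)
    (hsymm : Measure.map (X 0) ℙ = Measure.map (fun ω => -(X 0 ω)) ℙ)
    (f : ℝ → ℝ) (hf0 : ∀ u, 0 ≤ f u) (hfmeas : Measurable f)
    (hpdf : Measure.map (X 0) ℙ = (volume : Measure ℝ).withDensity (fun u => ENNReal.ofReal (f u)))
    (k0 K0 u0 : ℝ) (hk0 : 0 < k0) (hK0 : k0 ≤ K0) (hu0 : 0 < u0)
    (htail : ∀ u, u0 ≤ u → k0 * u ^ (-1 - α) ≤ f u ∧ f u ≤ K0 * u ^ (-1 - α))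
    (n : ℕ → ℕ) (hn : ∀ k, 0 < n k)
    (x : ℕ → ℝ) (hx : ∀ k, 0 < x k)
    (hLD : Tendsto (fun k => (n k : ℝ) / x k ^ α) atTop (nhds 0))
:
    (∃ C : ℝ, ∀ᶠ k in atTop,
        (n k : ℝ) * (ℙ {ω | X 0 ω > x k}).toReal / (ℙ {ω | (∑ i ∈ Finset.range (n k), X i ω) > x k}).toReal ≤ C) ∧
      (∃ c C : ℝ, 0 < c ∧ c ≤ C ∧
        ∀ᶠ k in atTop,
          c * ((n k : ℝ) * x k ^ (-α)) ≤ (n k : ℝ) * (ℙ {ω | X 0 ω > x k}).toReal ∧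
          (n k : ℝ) * (ℙ {ω | X 0 ω > x k}).toReal ≤ C * ((n k : ℝ) * x k ^ (-α))) := by
  obtain ⟨hα0, _⟩ := hα
  have hK : 0 < K0 := hk0.trans_le hK0
  have hxu : ∀ᶠ k in atTop, u0 ≤ x k := by
    have hpos : 0 < 1 / u0 ^ α := by positivity
    filter_upwards [hLD.eventually_lt_const hpos] with k hk
    by_contra! hlt
    have h1 : x k ^ α ≤ u0 ^ α := Real.rpow_le_rpow (hx k).le hlt.le hα0.le
    have h2 : 0 < x k ^ α := Real.rpow_pos_of_pos (hx k) _
    have h3 : (1 : ℝ) ≤ n k := by exact_mod_cast hn k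
    have h4 : 1 / u0 ^ α ≤ (n k : ℝ) / x k ^ α := div_le_div₀ (by linarith) h3 h2 h1
    linarith
  have htl := fun k (h : u0 ≤ x k) =>
    tail_aux α hα0 (X 0) (hmeas 0) f hpdf k0 K0 u0 hk0 hK0 hu0 htail (x k) h
  refine ⟨⟨4, ?_⟩, k0 / α, K0 / α, by positivity, by gcongr, ?_⟩
  · have hpos : 0 < α / (4 * K0) := by positivity
    filter_upwards [hxu, hLD.eventually_lt_const hpos] with k hk hk2
    have h1 := (htl k hk).2
    have h2 := sum_lower_aux X hmeas hindep hident hsymm (n k) (x k) _ rfl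
    simp only [measureReal_def] at h2
    set p := ((ℙ : Measure Ω) {ω | X 0 ω > x k}).toReal
    set q := ((ℙ : Measure Ω) {ω | (∑ i ∈ Finset.range (n k), X i ω) > x k}).toReal with hq
    have hp0 : 0 ≤ p := ENNReal.toReal_nonneg
    have hn0 : (0 : ℝ) ≤ n k := Nat.cast_nonneg _
    have h3 : (n k : ℝ) * p ≤ 1 / 4 := by
      calc (n k : ℝ) * p ≤ n k * (K0 / α * x k ^ (-α)) := by gcongr
        _ = K0 / α * (n k / x k ^ α) := by
            rw [Real.rpow_neg (hx k).le]; field_simp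
        _ ≤ K0 / α * (α / (4 * K0)) := by gcongr
        _ = 1 / 4 := by field_simp
    refine div_le_of_le_mul₀ ENNReal.toReal_nonneg (by norm_num) ?_
    nlinarith [mul_nonneg (mul_nonneg hn0 hp0) (sub_nonneg.mpr h3)]
  · filter_upwards [hxu] with k hk
    obtain ⟨h1, h2⟩ := htl k hk
    have hn0 : (0 : ℝ) ≤ n k := Nat.cast_nonneg _
    constructor
    · nlinarith [mul_le_mul_of_nonneg_left h1 hn0]
    · nlinarith [mul_le_mul_of_nonneg_left h2 hn0]
end

section
/- Let α ∈ (0,2). Let X_1, X_2, … be independent identically distributed real random variables whose common distribution is symmetric about 0 and has a probability density function f satisfying f(u) ≍ u^{-1-α} as u → ∞. For n ∈ ℕ let S_n := X_1 + … + X_n, and for n ∈ ℕ, x > 0, c ∈ (0,1) define p_0(n,x,c) := P(S_n > x and max_{1 ≤ j ≤ n} |X_j| ≤ c x). Then for any sequences (n_k) of positive integers, (x_k) of positive reals, and (c_k) in (0,1) with n_k / x_k^α → 0, (n_k x_k^{-α}) / c_k^{2α} → 0, and c_k → 0, one has p_0(n_k, x_k, c_k) / (n_k x_k^{-α}) → 0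 as k → ∞. -/
open MeasureTheory ProbabilityTheory Filter

theorem trunc_second (μ : Measure ℝ) [IsProbabilityMeasure μ] (α : ℝ) (hα : α ∈ Set.Ioo (0 : ℝ) 2)
    (hs : μ.map (fun u => -u) = μ) 
    (f : ℝ → ℝ) (hf0 : ∀ u, 0 ≤ f u) (hfmeas : Measurable f)
    (hpdf : μ = (volume : Measure ℝ).withDensity (fun u => ENNReal.ofReal (f u)))
    (K0 u0 : ℝ) (hK0 : 0 < K0) (hu0 : 0 < u0)
    (htail : ∀ u, u0 ≤ u → f u ≤ K0 * u ^ (-1 - α)) (y : ℝ) (hy : u0 ≤ y) :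
    ∫ u, (if |u| ≤ y then u else 0) ^ 2 ∂μ ≤ (u0 ^ α + 2 * K0 / (2 - α)) * y ^ (2 - α) := by
  obtain ⟨ha, hb⟩ := hα
  have hy0 : 0 < y := hu0.trans_le hy
  set h : ℝ → ℝ := (Set.Icc u0 y).indicator (fun u => u ^ 2) with hh
  have hm : Measurable h := (measurable_id.pow_const 2).indicator measurableSet_Icc
  have hbd : ∀ u, 0 ≤ h u ∧ h u ≤ y ^ 2 := by
    intro u
    simp only [hh, Set.indicator_apply]
    split_ifs with h1
    · exact ⟨by positivity, by have := h1.1; have := h1.2; gcongr; linarith⟩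
    · exact ⟨le_rfl, by positivity⟩
  have hint : Integrable h μ := Integrable.of_bound hm.aestronglyMeasurable (y ^ 2)
    (Eventually.of_forall fun u => by
      rw [Real.norm_eq_abs, abs_of_nonneg (hbd u).1]; exact (hbd u).2)
  have hint' : Integrable (fun u => h (-u)) μ :=
    Integrable.of_bound (hm.comp measurable_neg).aestronglyMeasurable (y ^ 2)
    (Eventually.of_forall fun u => by
      rw [Real.norm_eq_abs, abs_of_nonneg (hbd _).1]; exact (hbd _).2)
  have e1 : ∫ u, h (-u) ∂μ = ∫ u, h u ∂μ := by
    conv_rhs => rw [← hs]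
    rw [integral_map (by fun_prop) hm.aestronglyMeasurable]
  have e2 : ∫ u, h u ∂μ ≤ K0 * (y ^ (2 - α) / (2 - α)) := by
    have : ∫ u, h u ∂μ = ∫ u, f u * h u := by
      rw [hpdf, integral_withDensity_eq_integral_toReal_smul (by fun_prop) (by simp)]
      simp [ENNReal.toReal_ofReal, hf0]
    rw [this]
    have hii : IntervalIntegrable (fun u : ℝ => K0 * u ^ (1 - α)) volume u0 y :=
      (intervalIntegral.intervalIntegrable_rpow' (by linarith)).const_mul _
    calc ∫ u, f u * h u ≤ ∫ u, (Set.Ioc u0 y).indicator (fun u => K0 * u ^ (1 - α)) u := by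
          refine integral_mono_of_nonneg (Eventually.of_forall fun u => mul_nonneg (hf0 u) (hbd u).1) ?_ ?_
          · rw [integrable_indicator_iff measurableSet_Ioc]
            exact hii.1
          · have : ∀ᵐ u : ℝ, u ≠ u0 := by simp [ae_iff]
            filter_upwards [this] with u hu
            simp only [hh, Set.indicator_apply]
            by_cases h1 : u ∈ Set.Icc u0 y
            · have h2 : u ∈ Set.Ioc u0 y := ⟨lt_of_le_of_ne h1.1 hu.symm, h1.2⟩
              have hu' : 0 < u := hu0.trans_le h1.1
              rw [if_pos h1, if_pos h2]
              calc f u * u ^ 2 ≤ K0 * u ^ (-1 - α) * u ^ 2 := by gcongr; exact htail u h1.1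
                _ = K0 * u ^ (1 - α) := by
                  rw [mul_assoc, ← Real.rpow_natCast u 2, ← Real.rpow_add hu']
                  congr 2; push_cast; ring
            · have h2 : u ∉ Set.Ioc u0 y := fun h => h1 ⟨h.1.le, h.2⟩
              rw [if_neg h1, if_neg h2]; simp
      _ = K0 * ((y ^ (2 - α) - u0 ^ (2 - α)) / (2 - α)) := by
          rw [integral_indicator measurableSet_Ioc, ← intervalIntegral.integral_of_le hy,
            intervalIntegral.integral_const_mul, integral_rpow (Or.inl (by linarith))]
          rw [show 1 - α + 1 = 2 - α by ring]
      _ ≤ _ := by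
          have : 0 < 2 - α := by linarith
          have := Real.rpow_nonneg hu0.le (2 - α)
          gcongr; linarith
  have e3 : u0 ^ 2 ≤ u0 ^ α * y ^ (2 - α) := by
    calc u0 ^ 2 = u0 ^ α * u0 ^ (2 - α) := by
          rw [← Real.rpow_add hu0, ← Real.rpow_natCast]; congr 1; push_cast; ring
      _ ≤ _ := by gcongr
  calc ∫ u, (if |u| ≤ y then u else 0) ^ 2 ∂μ ≤ ∫ u, (u0 ^ 2 + (h u + h (-u))) ∂μ := by
        refine integral_mono_of_nonneg (Eventually.of_forall fun u => by positivity)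
          ((integrable_const _).add (hint.add hint')) (Eventually.of_forall fun u => ?_)
        have n1 := (hbd u).1
        have n2 := (hbd (-u)).1
        dsimp only
        split_ifs with h1
        · rw [abs_le] at h1
          rcases le_total u0 u with h2 | h2
          · have : h u = u ^ 2 := by simp [hh, h2, h1.2]
            nlinarith
          rcases le_total u0 (-u) with h3 | h3
          · have : h (-u) = u ^ 2 := by 
              have : -u ≤ y := by linarith
              simp [hh, Set.indicator_apply, h3, this]
            nlinarith
          · nlinarith
        · nlinarith [sq_nonneg u0]
    _ = u0 ^ 2 + 2 * ∫ u, h u ∂μ := by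
        have hi : Integrable (fun u => h u + h (-u)) μ := hint.add hint'
        rw [integral_add (integrable_const _) hi, integral_add hint hint', e1]
        simp; ring
    _ ≤ u0 ^ α * y ^ (2 - α) + 2 * (K0 * (y ^ (2 - α) / (2 - α))) := by gcongr
    _ = _ := by ring

theorem trunc_cheb {Ω : Type*} [MeasureSpace Ω] [IsProbabilityMeasure (ℙ : Measure Ω)]
    (X : ℕ → Ω → ℝ) (hmeas : ∀ i, Measurable (X i))
    (hindep : iIndepFun X ℙ)
    (hident : ∀ i, IdentDistrib (X i) (X 0) ℙ ℙ)
    (hsymm : Measure.map (X 0) ℙ = Measure.map (fun ω => -(X 0 ω)) ℙ)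
    (n : ℕ) (x y V : ℝ) (hx : 0 < x)
    (hV : ∫ u, (if |u| ≤ y then u else 0) ^ 2 ∂(Measure.map (X 0) ℙ) ≤ V) :
    (ℙ {ω | (∑ i ∈ Finset.range n, X i ω) > x ∧ ∀ j ∈ Finset.range n, |X j ω| ≤ y}).toReal
      ≤ n * V / x ^ 2 := by
  set g : ℝ → ℝ := fun u => if |u| ≤ y then u else 0 with hg
  have gm : Measurable g := Measurable.ite (measurableSet_le (by fun_prop) measurable_const)
    measurable_id measurable_const
  have gb : ∀ u, ‖g u‖ ≤ |y| := by
    intro u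
    simp only [hg]
    split_ifs with h
    · exact h.trans (le_abs_self y)
    · simp
  have hL : ∀ i, MemLp (g ∘ X i) 2 ℙ := fun i =>
    MemLp.of_bound (gm.comp (hmeas i)).aestronglyMeasurable |y| (Eventually.of_forall fun ω => gb _)
  have hid : ∀ i, IdentDistrib (g ∘ X i) (g ∘ X 0) ℙ ℙ := fun i => (hident i).comp gm
  have hI := hindep.comp (fun _ => g) (fun _ => gm)
  have h0 : ∫ ω, (g ∘ X 0) ω = 0 := by
    have h1 : ∫ ω, (g ∘ X 0) ω = ∫ u, g u ∂(Measure.map (X 0) ℙ) :=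
      (integral_map (hmeas 0).aemeasurable gm.aestronglyMeasurable).symm
    have h2 : ∫ u, g u ∂(Measure.map (X 0) ℙ) = - ∫ ω, (g ∘ X 0) ω := by
      rw [hsymm, integral_map (by have := hmeas 0; fun_prop) gm.aestronglyMeasurable, ← integral_neg]
      congr 1; ext ω
      simp only [hg, abs_neg, Function.comp]
      split_ifs <;> simp
    linarith
  have hv0 : variance (g ∘ X 0) ℙ ≤ V := by
    refine (variance_le_expectation_sq (hL 0).1).trans (le_trans (le_of_eq ?_) hV)
    exact (integral_map (hmeas 0).aemeasurable (gm.pow_const 2).aestronglyMeasurable).symm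
  have hvs : variance (∑ i ∈ Finset.range n, g ∘ X i) ℙ ≤ n * V := by
    rw [IndepFun.variance_sum (fun i _ => hL i) (fun i _ j _ hij => hI.indepFun hij)]
    calc _ = ∑ i ∈ Finset.range n, variance (g ∘ X 0) ℙ :=
          Finset.sum_congr rfl fun i _ => (hid i).variance_eq
      _ = n * variance (g ∘ X 0) ℙ := by simp
      _ ≤ _ := by gcongr
  have hms : ∫ ω, (∑ i ∈ Finset.range n, g ∘ X i) ω = 0 := by
    simp only [Finset.sum_apply]
    rw [integral_finsetSum _ (fun i _ => (hL i).integrable (by norm_num))]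
    exact Finset.sum_eq_zero fun i _ => by rw [(hid i).integral_eq, h0]
  have hch := meas_ge_le_variance_div_sq (memLp_finsetSum' (Finset.range n) (fun i _ => hL i)) hx
  rw [hms] at hch
  refine (ENNReal.toReal_le_of_le_ofReal (div_nonneg (variance_nonneg _ _) (by positivity))
    ((measure_mono ?_).trans hch)).trans (by gcongr)
  rintro ω ⟨h1, h2⟩
  have : (∑ i ∈ Finset.range n, g ∘ X i) ω = ∑ i ∈ Finset.range n, X i ω := by
    rw [Finset.sum_apply]
    exact Finset.sum_congr rfl fun i hi => by simp [hg, h2 i hi]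
  simp only [Set.mem_setOf_eq, this, sub_zero]
  exact h1.le.trans (le_abs_self _)



theorem p_zero_small
    {Ω : Type*} [MeasureSpace Ω] [IsProbabilityMeasure (ℙ : Measure Ω)]
    (α : ℝ) (hα : α ∈ Set.Ioo (0 : ℝ) 2)
    (X : ℕ → Ω → ℝ) (hmeas : ∀ i, Measurable (X i))
    (hindep : iIndepFun X ℙ)
    (hident : ∀ i, IdentDistrib (X i) (X 0) ℙ ℙ)
    (hsymm : Measure.map (X 0) ℙ = Measure.map (fun ω => -(X 0 ω)) ℙ)
    (f : ℝ → ℝ) (hf0 : ∀ u, 0 ≤ f u) (hfmeas : Measurable f)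
    (hpdf : Measure.map (X 0) ℙ = (volume : Measure ℝ).withDensity (fun u => ENNReal.ofReal (f u)))
    (k0 K0 u0 : ℝ) (hk0 : 0 < k0) (hK0 : k0 ≤ K0) (hu0 : 0 < u0)
    (htail : ∀ u, u0 ≤ u → k0 * u ^ (-1 - α) ≤ f u ∧ f u ≤ K0 * u ^ (-1 - α))
    (n : ℕ → ℕ) (hn : ∀ k, 0 < n k)
    (x : ℕ → ℝ) (hx : ∀ k, 0 < x k)
    (c : ℕ → ℝ) (hc : ∀ k, c k ∈ Set.Ioo (0 : ℝ) 1)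
    (hLD : Tendsto (fun k => (n k : ℝ) / x k ^ α) atTop (nhds 0))
    (hcc : Tendsto (fun k => (n k : ℝ) * x k ^ (-α) / c k ^ (2 * α)) atTop (nhds 0))
    (hc0 : Tendsto c atTop (nhds 0))
:
    Tendsto (fun k => (ℙ {ω | (∑ i ∈ Finset.range (n k), X i ω) > x k ∧ ∀ j ∈ Finset.range (n k), |X j ω| ≤ c k * x k}).toReal / ((n k : ℝ) * x k ^ (-α))) atTop (nhds 0) := by


  have ha := hα.1
  have hb := hα.2
  have hK : 0 < K0 := hk0.trans_le hK0
  set C : ℝ := u0 ^ α + 2 * K0 / (2 - α) with hC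
  have hev : ∀ᶠ k in atTop, u0 ≤ c k * x k := by
    filter_upwards [hcc.eventually_lt_const (Real.rpow_pos_of_pos hu0 (-α))] with k hk
    have hck := (hc k).1
    have hxk := hx k
    by_contra hlt
    push Not at hlt
    have h1 : u0 ^ (-α) < (c k * x k) ^ (-α) :=
      Real.rpow_lt_rpow_of_neg (by positivity) hlt (by linarith)
    rw [Real.mul_rpow hck.le hxk.le] at h1
    have h2 : c k ^ (-α) ≤ c k ^ (-(2 * α)) :=
      Real.rpow_le_rpow_of_exponent_ge hck (hc k).2.le (by linarith)
    have h3 : (1 : ℝ) ≤ n k := by exact_mod_cast hn k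
    rw [div_eq_mul_inv, ← Real.rpow_neg hck.le] at hk
    have p1 : 0 < x k ^ (-α) := by positivity
    have p2 : 0 < c k ^ (-(2 * α)) := by positivity
    have h4 : c k ^ (-α) * x k ^ (-α) ≤ c k ^ (-(2 * α)) * x k ^ (-α) := by gcongr
    nlinarith [mul_pos p1 p2]
  have hsym' : Measure.map (fun u => -u) (Measure.map (X 0) ℙ) = Measure.map (X 0) ℙ := by
    rw [Measure.map_map (by fun_prop) (hmeas 0)]
    exact hsymm.symm
  have hpm : IsProbabilityMeasure (Measure.map (X 0) (ℙ : Measure Ω)) :=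
    Measure.isProbabilityMeasure_map (hmeas 0).aemeasurable
  have hlim : Tendsto (fun k => C * c k ^ (2 - α)) atTop (nhds 0) := by
    have := (hc0.rpow_const (p := 2 - α) (Or.inr (by linarith))).const_mul C
    rwa [Real.zero_rpow (by linarith), mul_zero] at this
  refine squeeze_zero' (Eventually.of_forall fun k => ?_) ?_ hlim
  · have := hx k
    positivity
  · filter_upwards [hev] with k hk
    have hck := (hc k).1
    have hxk := hx k
    have hnk : (0 : ℝ) < n k := by exact_mod_cast hn k
    have hB := trunc_cheb X hmeas hindep hident hsymm (n k) (x k) (c k * x k) _ hxk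
      (trunc_second _ α hα hsym' f hf0 hfmeas hpdf K0 u0 hK hu0 (fun u hu => (htail u hu).2) _ hk)
    rw [div_le_iff₀ (by positivity)]
    refine hB.trans (le_of_eq ?_)
    rw [← hC, Real.mul_rpow hck.le hxk.le, div_eq_iff (by positivity)]
    have : x k ^ (2 - α) = x k ^ (-α) * x k ^ 2 := by
      rw [← Real.rpow_natCast, ← Real.rpow_add hxk]; congr 1; push_cast; ring
    rw [this]; ring
end

section
/- Let α ∈ (0,2). Let X_1, X_2, … be independent identically distributed real random variables whose common distribution is symmetric about 0 and has a probability density function f satisfying f(u) ≍ u^{-1-α} as u → ∞. For n ∈ ℕ let S_n := X_1 + … + X_n, and for n ∈ ℕ, x > 0, c ∈ (0,1) define p_{≥2}(n,x,c) := P(S_n > x and there exist distinct i, j ∈ {1,…,n} with |X_i| > c x and |X_j| > c x). Then for any sequences (n_k) of positive integers, (x_k) of positive reals, and (c_k) in (0,1) with n_k / x_k^α → 0, (n_k x_k^{-α}) / c_k^{2α} → 0, and c_k → 0, one has p_{≥2}(n_k, x_k, c_k) / (n_k x_k^{-α}) → 0 as k → ∞. -/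
open MeasureTheory ProbabilityTheory Filter

theorem right_tail (μ : Measure ℝ) (α : ℝ) (hα : 0 < α) (f : ℝ → ℝ)
    (hpdf : μ = (volume : Measure ℝ).withDensity (fun u => ENNReal.ofReal (f u)))
    (K0 u0 : ℝ) (hK0 : 0 ≤ K0) (hu0 : 0 < u0)
    (htail : ∀ u, u0 ≤ u → f u ≤ K0 * u ^ (-1 - α)) (t : ℝ) (ht : u0 ≤ t) :
    μ (Set.Ioi t) ≤ ENNReal.ofReal (K0 / α * t ^ (-α)) := by
  have ht0 : 0 < t := hu0.trans_le ht
  rw [hpdf, withDensity_apply _ measurableSet_Ioi]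
  calc ∫⁻ u in Set.Ioi t, ENNReal.ofReal (f u)
      ≤ ∫⁻ u in Set.Ioi t, ENNReal.ofReal (K0 * u ^ (-1 - α)) := by
        apply setLIntegral_mono' measurableSet_Ioi
        intro u hu
        exact ENNReal.ofReal_le_ofReal (htail u (ht.trans (le_of_lt hu)))
    _ = ENNReal.ofReal (∫ u in Set.Ioi t, K0 * u ^ (-1 - α)) := by
        rw [ofReal_integral_eq_lintegral_ofReal]
        · exact (integrableOn_Ioi_rpow_of_lt (by linarith) ht0).const_mul K0
        · filter_upwards [ae_restrict_mem measurableSet_Ioi] with u hu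
          have : 0 < u := ht0.trans hu
          simp only [Pi.zero_apply]
          positivity
    _ = _ := by
        rw [integral_const_mul, integral_Ioi_rpow_of_lt (by linarith) ht0]
        congr 1
        rw [show -1 - α + 1 = -α by ring]
        field_simp

theorem tail_bound {Ω : Type*} [MeasureSpace Ω] [IsProbabilityMeasure (ℙ : Measure Ω)]
    (α : ℝ) (hα : 0 < α) (Y : Ω → ℝ) (hY : Measurable Y)
    (hsymm : Measure.map Y ℙ = Measure.map (fun ω => -(Y ω)) ℙ)
    (f : ℝ → ℝ)
    (hpdf : Measure.map Y ℙ = (volume : Measure ℝ).withDensity (fun u => ENNReal.ofReal (f u)))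
    (K0 u0 : ℝ) (hK0 : 0 ≤ K0) (hu0 : 0 < u0)
    (htail : ∀ u, u0 ≤ u → f u ≤ K0 * u ^ (-1 - α)) (t : ℝ) (ht : 0 < t) :
    (ℙ : Measure Ω).real {ω | |Y ω| > t} ≤ (2 * K0 / α + u0 ^ α) * t ^ (-α) := by
  have htp : 0 < t ^ (-α) := Real.rpow_pos_of_pos ht _
  rcases le_total u0 t with h | h
  · have h1 := right_tail (Measure.map Y ℙ) α hα f hpdf K0 u0 hK0 hu0 htail t h
    have h2 := h1
    rw [hsymm, Measure.map_apply (f := fun ω => -(Y ω)) hY.neg measurableSet_Ioi] at h2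
    rw [Measure.map_apply hY measurableSet_Ioi] at h1
    have h1' := ENNReal.toReal_le_of_le_ofReal (by positivity) h1
    have h2' := ENNReal.toReal_le_of_le_ofReal (by positivity) h2
    have hsub : {ω | |Y ω| > t} ⊆ (Y ⁻¹' Set.Ioi t) ∪ ((fun ω => -(Y ω)) ⁻¹' Set.Ioi t) := by
      intro ω hω
      have hω2 : t < |Y ω| := hω
      exact lt_abs.mp hω2
    have h3 := (measureReal_mono hsub (μ := (ℙ : Measure Ω))).trans (measureReal_union_le _ _)
    simp only [Measure.real] at h3 ⊢
    have : 0 ≤ u0 ^ α * t ^ (-α) := by positivity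
    have e : (2 * K0 / α + u0 ^ α) * t ^ (-α)
      = K0 / α * t ^ (-α) + K0 / α * t ^ (-α) + u0 ^ α * t ^ (-α) := by ring
    rw [e]
    linarith
  · have h1 : t ^ α ≤ u0 ^ α := Real.rpow_le_rpow ht.le h hα.le
    have h2 : t ^ α * t ^ (-α) = 1 := by rw [← Real.rpow_add ht]; simp
    have h3 : 0 ≤ 2 * K0 / α := by positivity
    calc (ℙ : Measure Ω).real {ω | |Y ω| > t} ≤ 1 := measureReal_le_one
      _ = t ^ α * t ^ (-α) := h2.symm
      _ ≤ _ := by gcongr; linarith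

theorem pair_bound {Ω : Type*} [MeasureSpace Ω] [IsProbabilityMeasure (ℙ : Measure Ω)]
    (X : ℕ → Ω → ℝ) (hindep : iIndepFun X ℙ)
    (hident : ∀ i, IdentDistrib (X i) (X 0) ℙ ℙ) (n : ℕ) (x t b : ℝ)
    (hb : (ℙ : Measure Ω).real {ω | |X 0 ω| > t} ≤ b) :
    (ℙ {ω | (∑ i ∈ Finset.range n, X i ω) > x ∧ ∃ i ∈ Finset.range n, ∃ j ∈ Finset.range n,
      i ≠ j ∧ |X i ω| > t ∧ |X j ω| > t}).toReal ≤ (n : ℝ) ^ 2 * b ^ 2 := by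
  have hA : MeasurableSet {y : ℝ | |y| > t} := measurableSet_lt measurable_const measurable_norm
  have hi : ∀ i, (ℙ : Measure Ω).real (X i ⁻¹' {y : ℝ | |y| > t}) ≤ b := by
    intro i
    have := (hident i).measure_mem_eq hA
    simp only [Measure.real, this]
    exact hb
  have hb0 : 0 ≤ b := measureReal_nonneg.trans hb
  have hsub : {ω | (∑ i ∈ Finset.range n, X i ω) > x ∧ ∃ i ∈ Finset.range n,
      ∃ j ∈ Finset.range n, i ≠ j ∧ |X i ω| > t ∧ |X j ω| > t} ⊆
      ⋃ p ∈ (Finset.range n).offDiag,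
        (X p.1 ⁻¹' {y : ℝ | |y| > t} ∩ X p.2 ⁻¹' {y : ℝ | |y| > t}) := by
    rintro ω ⟨-, i, hi, j, hj, hij, h1, h2⟩
    simp only [Set.mem_iUnion]
    exact ⟨(i, j), Finset.mem_offDiag.2 ⟨hi, hj, hij⟩, h1, h2⟩
  have h1 := measureReal_mono hsub (measure_ne_top (ℙ : Measure Ω) _)
  refine h1.trans ((measureReal_biUnion_finset_le _ _).trans ?_)
  have h2 : ∀ p ∈ (Finset.range n).offDiag, (ℙ : Measure Ω).real
      (X p.1 ⁻¹' {y : ℝ | |y| > t} ∩ X p.2 ⁻¹' {y : ℝ | |y| > t}) ≤ b ^ 2 := by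
    intro p hp
    have hne := (Finset.mem_offDiag.1 hp).2.2
    have := (hindep.indepFun hne).measure_inter_preimage_eq_mul _ _ hA hA
    simp only [Measure.real, this, ENNReal.toReal_mul]
    rw [pow_two]
    exact mul_le_mul (hi _) (hi _) ENNReal.toReal_nonneg hb0
  refine (Finset.sum_le_card_nsmul _ _ _ h2).trans ?_
  rw [nsmul_eq_mul]
  gcongr
  rw [Finset.offDiag_card, Finset.card_range]
  calc ((n * n - n : ℕ) : ℝ) ≤ ((n * n : ℕ) : ℝ) := by exact_mod_cast Nat.sub_le _ _
    _ = _ := by push_cast; ring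

theorem p_ge_two_small
    {Ω : Type*} [MeasureSpace Ω] [IsProbabilityMeasure (ℙ : Measure Ω)]
    (α : ℝ) (hα : α ∈ Set.Ioo (0 : ℝ) 2)
    (X : ℕ → Ω → ℝ) (hmeas : ∀ i, Measurable (X i))
    (hindep : iIndepFun X ℙ)
    (hident : ∀ i, IdentDistrib (X i) (X 0) ℙ ℙ)
    (hsymm : Measure.map (X 0) ℙ = Measure.map (fun ω => -(X 0 ω)) ℙ)
    (f : ℝ → ℝ) (hf0 : ∀ u, 0 ≤ f u) (hfmeas : Measurable f)
    (hpdf : Measure.map (X 0) ℙ = (volume : Measure ℝ).withDensity (fun u => ENNReal.ofReal (f u)))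
    (k0 K0 u0 : ℝ) (hk0 : 0 < k0) (hK0 : k0 ≤ K0) (hu0 : 0 < u0)
    (htail : ∀ u, u0 ≤ u → k0 * u ^ (-1 - α) ≤ f u ∧ f u ≤ K0 * u ^ (-1 - α))
    (n : ℕ → ℕ) (hn : ∀ k, 0 < n k)
    (x : ℕ → ℝ) (hx : ∀ k, 0 < x k)
    (c : ℕ → ℝ) (hc : ∀ k, c k ∈ Set.Ioo (0 : ℝ) 1)
    (hLD : Tendsto (fun k => (n k : ℝ) / x k ^ α) atTop (nhds 0))
    (hcc : Tendsto (fun k => (n k : ℝ) * x k ^ (-α) / c k ^ (2 * α)) atTop (nhds 0))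
    (hc0 : Tendsto c atTop (nhds 0))
:
    Tendsto (fun k => (ℙ {ω | (∑ i ∈ Finset.range (n k), X i ω) > x k ∧ ∃ i ∈ Finset.range (n k), ∃ j ∈ Finset.range (n k), i ≠ j ∧ |X i ω| > c k * x k ∧ |X j ω| > c k * x k}).toReal / ((n k : ℝ) * x k ^ (-α))) atTop (nhds 0) := by
  have hK : 0 ≤ K0 := hk0.le.trans hK0
  have hlim := hcc.const_mul ((2 * K0 / α + u0 ^ α) ^ 2)
  rw [mul_zero] at hlim
  refine squeeze_zero (fun k => ?_) (fun k => ?_) hlim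
  · have := hx k
    positivity
  · have hxk := hx k
    have hck := (hc k).1
    have hnk : (0 : ℝ) < n k := by exact_mod_cast hn k
    have hb := pair_bound X hindep hident (n k) (x k) (c k * x k) _
      (tail_bound α hα.1 (X 0) (hmeas 0) hsymm f hpdf K0 u0 hK hu0 (fun u hu => (htail u hu).2)
        (c k * x k) (mul_pos hck hxk))
    have hxp : 0 < x k ^ (-α) := Real.rpow_pos_of_pos hxk _
    rw [div_le_iff₀ (by positivity)]
    refine hb.trans (le_of_eq ?_)
    have e : c k ^ (2 * α) = ((c k ^ (-α)) ^ 2)⁻¹ := by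
      rw [← Real.rpow_natCast, ← Real.rpow_mul hck.le, ← Real.rpow_neg hck.le]
      congr 1
      push_cast
      ring
    rw [e, Real.mul_rpow hck.le hxk.le, div_inv_eq_mul]
    ring
end

section
/- Let α ∈ (0,2). Let X_1, X_2, … be independent identically distributed real random variables whose common distribution is symmetric about 0 and has a probability density function f satisfying f(u) ≍ u^{-1-α} as u → ∞. For n ∈ ℕ let S_n := X_1 + … + X_n, and for n ∈ ℕ, x > 0, c ∈ (0,1) define p_{1,0}(n,x,c) := P(S_n > x and there exists i ∈ {1,…,n} with c x < |X_i| ≤ x and max_{j ∈ {1,…,n}, j ≠ i} |X_j| ≤ c x). Then for any sequences (n_k) of positive integers, (x_k) of positive reals, and (c_k) in (0,1) with n_k / x_k^α → 0, (n_k x_k^{-α}) / c_k^{2α} → 0, and c_k → 0, one has p_{1,0}(n_k, x_k, c_k) / (n_k x_k^{-α}) → 0 as k → ∞. -/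
open MeasureTheory ProbabilityTheory Filter

/-- The law hypotheses, for a measure on the line. -/
structure TailLaw (μ : Measure ℝ) (α K u0 : ℝ) (f : ℝ → ℝ) : Prop where
  prob : IsProbabilityMeasure μ
  symm : μ = μ.map (fun u => -u)
  fmeas : Measurable f
  pdf : μ = (volume : Measure ℝ).withDensity (fun u => ENNReal.ofReal (f u))
  Kpos : 0 < K
  u0pos : 0 < u0
  a0 : 0 < α
  a2 : α < 2
  tail : ∀ u, u0 ≤ u → f u ≤ K * u ^ (-1 - α)

namespace TailLaw
variable {μ : Measure ℝ} {α K u0 : ℝ} {f : ℝ → ℝ}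

lemma lint_le (h : TailLaw μ α K u0 f) {s : Set ℝ} (hs : MeasurableSet s) (hsu : ∀ u ∈ s, u0 ≤ u)
    {g : ℝ → ℝ} (hg : Measurable g) (hg0 : ∀ u, 0 ≤ g u) :
    ∫⁻ u in s, ENNReal.ofReal (g u) ∂μ ≤ ∫⁻ u in s, ENNReal.ofReal (K * u ^ (-1 - α) * g u) := by
  have hpdf := h.pdf
  have hf := h.fmeas
  rw [hpdf, setLIntegral_withDensity_eq_setLIntegral_mul _ (by fun_prop) (by fun_prop) hs]
  apply setLIntegral_mono (by fun_prop)
  intro u hu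
  have h1 := h.tail u (hsu u hu)
  simp only [Pi.mul_apply]
  rw [← ENNReal.ofReal_mul' (hg0 u)]
  exact ENNReal.ofReal_le_ofReal (mul_le_mul_of_nonneg_right h1 (hg0 u))

lemma lint_neg (h : TailLaw μ α K u0 f) {g : ℝ → ENNReal} (hg : Measurable g) :
    ∫⁻ u, g (-u) ∂μ = ∫⁻ u, g u ∂μ := by
  conv_rhs => rw [h.symm]
  rw [lintegral_map hg measurable_neg]

lemma tail_le (h : TailLaw μ α K u0 f) {M : ℝ} (hM : u0 ≤ M) :
    μ {u | M < |u|} ≤ ENNReal.ofReal (2 * K / α * M ^ (-α)) := by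
  have hM0 : 0 < M := h.u0pos.trans_le hM
  have ha := h.a0
  have hK := h.Kpos
  have h1 : μ (Set.Ioi M) ≤ ENNReal.ofReal (K / α * M ^ (-α)) := by
    have := h.lint_le (s := Set.Ioi M) measurableSet_Ioi (fun u hu => hM.trans (le_of_lt hu))
      (g := fun _ => 1) measurable_const (fun _ => zero_le_one)
    simp only [ENNReal.ofReal_one, lintegral_const, one_mul, mul_one, Measure.restrict_apply_univ] at this
    refine this.trans ?_
    rw [← ofReal_integral_eq_lintegral_ofReal]
    · rw [integral_const_mul, integral_Ioi_rpow_of_lt (by linarith) hM0]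
      apply ENNReal.ofReal_le_ofReal
      have : -1 - α + 1 = -α := by ring
      rw [this, neg_div_neg_eq]
      apply le_of_eq; ring
    · exact (integrableOn_Ioi_rpow_of_lt (by linarith) hM0).const_mul _
    · refine (ae_restrict_mem measurableSet_Ioi).mono fun u hu => ?_
      have : 0 < u := hM0.trans hu
      simp only [Pi.zero_apply]
      positivity
  have h2 : μ {u | M < -u} = μ (Set.Ioi M) := by
    conv_rhs => rw [h.symm]
    rw [Measure.map_apply measurable_neg measurableSet_Ioi]
    rfl
  have h3 : {u : ℝ | M < |u|} ⊆ Set.Ioi M ∪ {u | M < -u} := by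
    intro u hu
    have hu' : M < |u| := hu
    exact lt_abs.1 hu'
  calc μ {u | M < |u|} ≤ μ (Set.Ioi M) + μ {u | M < -u} := (measure_mono h3).trans (measure_union_le _ _)
    _ ≤ ENNReal.ofReal (K / α * M ^ (-α)) + ENNReal.ofReal (K / α * M ^ (-α)) := by
      rw [h2]; exact add_le_add h1 h1
    _ = _ := by
      rw [← ENNReal.ofReal_add (by positivity) (by positivity)]
      congr 1; ring

lemma ioc_le (h : TailLaw μ α K u0 f) {a b : ℝ} (ha : u0 ≤ a) (hab : a ≤ b) :
    μ (Set.Ioc a b) ≤ ENNReal.ofReal (K * a ^ (-1 - α) * (b - a)) := by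
  have ha0 := h.u0pos.trans_le ha
  have hα := h.a0
  have hK := h.Kpos
  have := h.lint_le (s := Set.Ioc a b) measurableSet_Ioc (fun u hu => ha.trans (le_of_lt hu.1))
      (g := fun _ => 1) measurable_const (fun _ => zero_le_one)
  simp only [ENNReal.ofReal_one, lintegral_const, one_mul, mul_one, Measure.restrict_apply_univ] at this
  refine this.trans ?_
  calc _ ≤ ∫⁻ u in Set.Ioc a b, ENNReal.ofReal (K * a ^ (-1 - α)) := by
        apply setLIntegral_mono measurable_const
        intro u hu
        apply ENNReal.ofReal_le_ofReal
        apply mul_le_mul_of_nonneg_left _ hK.le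
        exact Real.rpow_le_rpow_of_nonpos ha0 hu.1.le (by linarith)
    _ = _ := by
      simp only [lintegral_const, Measure.restrict_apply_univ, Real.volume_Ioc]
      rw [← ENNReal.ofReal_mul (by positivity)]

end TailLaw

/-- truncation -/
noncomputable def trc (M : ℝ) : ℝ → ℝ := fun u => if |u| ≤ M then u else 0

lemma trc_meas (M : ℝ) : Measurable (trc M) :=
  Measurable.ite (measurableSet_le (by fun_prop) measurable_const) measurable_id measurable_const

lemma trc_abs {M : ℝ} (hM : 0 ≤ M) (u : ℝ) : |trc M u| ≤ M := by
  unfold trc; split_ifs with h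
  · exact h
  · simpa using hM

lemma trc_neg (M u : ℝ) : trc M (-u) = - trc M u := by
  unfold trc; simp only [abs_neg]; split_ifs <;> simp

namespace TailLaw
variable {μ : Measure ℝ} {α K u0 : ℝ} {f : ℝ → ℝ}

lemma mean_zero (h : TailLaw μ α K u0 f) (M : ℝ) : ∫ u, trc M u ∂μ = 0 := by
  have h1 : ∫ u, trc M u ∂μ = ∫ u, trc M (-u) ∂μ := by
    conv_lhs => rw [h.symm]
    rw [integral_map measurable_neg.aemeasurable (trc_meas M).aestronglyMeasurable]
  simp only [trc_neg, integral_neg] at h1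
  linarith

lemma sq_le (h : TailLaw μ α K u0 f) {M : ℝ} (hM : u0 ≤ M) :
    ∫ u, (trc M u)^2 ∂μ ≤ (u0 ^ α + 2 * K / (2 - α)) * M ^ (2 - α) := by
  have hp := h.prob
  have hu0 := h.u0pos
  have hM0 : 0 < M := h.u0pos.trans_le hM
  have ha := h.a0
  have ha2 := h.a2
  have hK := h.Kpos
  have h2a : 0 < 2 - α := by linarith
  have hI : ∫⁻ u in Set.Ioc u0 M, ENNReal.ofReal (u^2) ∂μ ≤ ENNReal.ofReal (K / (2 - α) * M ^ (2 - α)) := by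
    refine (h.lint_le measurableSet_Ioc (fun u hu => hu.1.le) (g := fun u => u^2) (by fun_prop)
      (fun u => sq_nonneg u)).trans ?_
    have hint : IntegrableOn (fun u : ℝ => K * u ^ (1 - α)) (Set.Ioc 0 M) :=
      ((intervalIntegrable_iff_integrableOn_Ioc_of_le hM0.le).1
        (intervalIntegral.intervalIntegrable_rpow' (by linarith))).const_mul _
    calc _ ≤ ∫⁻ u in Set.Ioc u0 M, ENNReal.ofReal (K * u ^ (1 - α)) := by
          apply setLIntegral_mono (by fun_prop)
          intro u hu
          have hu1 : 0 < u := hu0.trans hu.1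
          apply ENNReal.ofReal_le_ofReal
          rw [mul_assoc, ← Real.rpow_natCast, ← Real.rpow_add hu1]
          apply le_of_eq; congr 2; push_cast; ring
      _ ≤ ∫⁻ u in Set.Ioc 0 M, ENNReal.ofReal (K * u ^ (1 - α)) :=
          lintegral_mono_set (Set.Ioc_subset_Ioc_left hu0.le)
      _ = _ := by
        rw [← ofReal_integral_eq_lintegral_ofReal hint]
        · rw [← intervalIntegral.integral_of_le hM0.le, intervalIntegral.integral_const_mul,
            integral_rpow (Or.inl (by linarith))]
          have : 1 - α + 1 = 2 - α := by ring
          rw [this, Real.zero_rpow h2a.ne']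
          congr 1; ring
        · refine (ae_restrict_mem measurableSet_Ioc).mono fun u hu => ?_
          have : 0 < u := hu.1
          simp only [Pi.zero_apply]
          positivity
  set G : ℝ → ENNReal := (Set.Ioc u0 M).indicator (fun u => ENNReal.ofReal (u^2)) with hG
  have hGm : Measurable G := Measurable.indicator (by fun_prop) measurableSet_Ioc
  have hGi : ∫⁻ u, G u ∂μ = ∫⁻ u in Set.Ioc u0 M, ENNReal.ofReal (u^2) ∂μ :=
    lintegral_indicator measurableSet_Ioc _
  have hpt : ∀ u, ENNReal.ofReal ((trc M u)^2) ≤ ENNReal.ofReal (u0^2) + (G u + G (-u)) := by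
    intro u
    by_cases h1 : |u| ≤ u0
    · refine le_trans (ENNReal.ofReal_le_ofReal ?_) le_self_add
      have : |trc M u| ≤ u0 := by
        unfold trc; split_ifs
        · exact h1
        · simpa using hu0.le
      exact sq_le_sq' (abs_le.1 this).1 (abs_le.1 this).2
    by_cases h2 : |u| ≤ M
    · have ht : trc M u = u := if_pos h2
      rw [ht]
      push Not at h1
      rcases lt_abs.1 h1 with h3 | h3
      · have : G u = ENNReal.ofReal (u^2) := 
          Set.indicator_of_mem (show u ∈ Set.Ioc u0 M from ⟨h3, (abs_le.1 h2).2⟩) _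
        rw [← this]
        exact le_self_add.trans le_add_self
      · have : G (-u) = ENNReal.ofReal (u^2) := by
          rw [hG, Set.indicator_of_mem (show -u ∈ Set.Ioc u0 M from ⟨h3, by linarith [(abs_le.1 h2).1]⟩)]
          simp
        rw [← this]
        exact le_add_self.trans le_add_self
    · have ht : trc M u = 0 := if_neg h2
      simp [ht]
  have hL : ∫⁻ u, ENNReal.ofReal ((trc M u)^2) ∂μ ≤
      ENNReal.ofReal (u0^2 + (K / (2 - α) * M ^ (2 - α) + K / (2 - α) * M ^ (2 - α))) := by
    calc _ ≤ ∫⁻ u, (ENNReal.ofReal (u0^2) + (G u + G (-u))) ∂μ := lintegral_mono hpt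
      _ = ENNReal.ofReal (u0^2) + (∫⁻ u, G u ∂μ + ∫⁻ u, G u ∂μ) := by
        rw [lintegral_add_left measurable_const, lintegral_add_left hGm, h.lint_neg hGm]
        simp
      _ ≤ _ := by
        rw [ENNReal.ofReal_add (by positivity) (by positivity),
          ENNReal.ofReal_add (by positivity) (by positivity), hGi]
        gcongr
  rw [integral_eq_lintegral_of_nonneg_ae (Eventually.of_forall fun u => sq_nonneg _)
    ((trc_meas M).pow_const 2).aestronglyMeasurable]
  refine (ENNReal.toReal_mono ENNReal.ofReal_ne_top hL).trans ?_
  rw [ENNReal.toReal_ofReal (by positivity)]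
  have : u0 ^ 2 ≤ u0 ^ α * M ^ (2 - α) := by
    calc u0 ^ 2 = u0 ^ α * u0 ^ (2 - α) := by
          rw [← Real.rpow_add hu0, ← Real.rpow_natCast]; congr 1; push_cast; ring
      _ ≤ _ := by gcongr
  have e : (u0 ^ α + 2 * K / (2 - α)) * M ^ (2 - α) = u0 ^ α * M ^ (2 - α) +
     (K / (2 - α) * M ^ (2 - α) + K / (2 - α) * M ^ (2 - α)) := by ring
  rw [e]
  gcongr

end TailLaw

lemma sum_dev {Ω : Type*} [MeasureSpace Ω] [IsProbabilityMeasure (ℙ : Measure Ω)]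
    {α K u0 : ℝ} {f : ℝ → ℝ}
    (X : ℕ → Ω → ℝ) (hmeas : ∀ i, Measurable (X i))
    (hindep : iIndepFun X ℙ) (hident : ∀ i, IdentDistrib (X i) (X 0) ℙ ℙ)
    (h : TailLaw (Measure.map (X 0) ℙ) α K u0 f) {M : ℝ} (hM : u0 ≤ M) (s : Finset ℕ) :
    ℙ {ω | M ≤ |∑ j ∈ s, trc M (X j ω)|} ≤
      ENNReal.ofReal (s.card * ((u0 ^ α + 2 * K / (2 - α)) * M ^ (2 - α)) / M ^ 2) := by
  have hM0 : 0 < M := h.u0pos.trans_le hM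
  have hYm : ∀ j, Measurable (trc M ∘ X j) := fun j => (trc_meas M).comp (hmeas j)
  have hL : ∀ j, MemLp (trc M ∘ X j) 2 ℙ := fun j =>
    MemLp.of_bound (hYm j).aestronglyMeasurable M (Eventually.of_forall fun ω => trc_abs hM0.le _)
  have hYid : ∀ j, IdentDistrib (trc M ∘ X j) (trc M ∘ X 0) ℙ ℙ := fun j => (hident j).comp (trc_meas M)
  have hmean : ∀ j, ∫ ω, (trc M ∘ X j) ω = 0 := by
    intro j
    rw [(hYid j).integral_eq, ← h.mean_zero M,
      integral_map (hmeas 0).aemeasurable (trc_meas M).aestronglyMeasurable]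
    rfl
  have hvar : ∀ j, variance (trc M ∘ X j) ℙ ≤ (u0 ^ α + 2 * K / (2 - α)) * M ^ (2 - α) := by
    intro j
    rw [(hYid j).variance_eq]
    refine (variance_le_expectation_sq (hYm 0).aestronglyMeasurable).trans ?_
    refine le_trans (le_of_eq ?_) (h.sq_le hM)
    rw [integral_map (hmeas 0).aemeasurable ((trc_meas M).pow_const 2).aestronglyMeasurable]
    rfl
  have hYind : iIndepFun (fun j => trc M ∘ X j) ℙ := hindep.comp _ (fun _ => trc_meas M)
  have hvs : variance (∑ j ∈ s, trc M ∘ X j) ℙ ≤ s.card * ((u0 ^ α + 2 * K / (2 - α)) * M ^ (2 - α)) := by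
    rw [IndepFun.variance_sum (fun j _ => hL j) (fun i _ j _ hij => hYind.indepFun hij)]
    refine (Finset.sum_le_sum (fun j _ => hvar j)).trans ?_
    simp
  have hms : ∫ ω, (∑ j ∈ s, trc M ∘ X j) ω = 0 := by
    simp only [Finset.sum_apply]
    rw [integral_finsetSum _ (fun j _ => (hL j).integrable (by norm_num))]
    exact Finset.sum_eq_zero fun j _ => hmean j
  have := meas_ge_le_variance_div_sq (memLp_finsetSum' s (fun j _ => hL j)) hM0
  rw [hms] at this
  simp only [sub_zero, Finset.sum_apply, Function.comp] at this
  refine this.trans (ENNReal.ofReal_le_ofReal ?_)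
  gcongr

lemma one_event {Ω : Type*} [MeasureSpace Ω] [IsProbabilityMeasure (ℙ : Measure Ω)]
    {α K u0 : ℝ} {f : ℝ → ℝ}
    (X : ℕ → Ω → ℝ) (hmeas : ∀ i, Measurable (X i))
    (hindep : iIndepFun X ℙ) (hident : ∀ i, IdentDistrib (X i) (X 0) ℙ ℙ)
    (h : TailLaw (Measure.map (X 0) ℙ) α K u0 f) (n : ℕ) (x c : ℝ) (hx : 0 < x) (hc : 0 < c)
    (hc2 : c ≤ 1 / 2) (hcx : u0 ≤ c * x) (i : ℕ) (hi : i ∈ Finset.range n) :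
    ℙ {ω | (∑ i ∈ Finset.range n, X i ω) > x ∧ c * x < |X i ω| ∧ |X i ω| ≤ x ∧
      ∀ j ∈ Finset.range n, j ≠ i → |X j ω| ≤ c * x} ≤
    ENNReal.ofReal (K * (x / 2) ^ (-1 - α) * (c * x)) +
    ENNReal.ofReal (2 * K / α * (c * x) ^ (-α)) *
      ENNReal.ofReal (n * ((u0 ^ α + 2 * K / (2 - α)) * (c * x) ^ (2 - α)) / (c * x) ^ 2) := by
  have hα := h.a0
  have hα2 := h.a2
  have hK := h.Kpos
  have hu0 := h.u0pos
  set s := (Finset.range n).erase i with hs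
  set T : Ω → ℝ := fun ω => ∑ j ∈ s, trc (c * x) (X j ω) with hT
  have hsub : {ω | (∑ i ∈ Finset.range n, X i ω) > x ∧ c * x < |X i ω| ∧ |X i ω| ≤ x ∧
      ∀ j ∈ Finset.range n, j ≠ i → |X j ω| ≤ c * x} ⊆
      X i ⁻¹' (Set.Ioc (x - c * x) x) ∪ (X i ⁻¹' {u | c * x < |u|} ∩ T ⁻¹' {t | c * x ≤ |t|}) := by
    rintro ω ⟨h1, h2, h3, h4⟩
    have e : ∑ i ∈ Finset.range n, X i ω = X i ω + T ω := by
      rw [← Finset.add_sum_erase _ _ hi]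
      congr 1
      apply Finset.sum_congr rfl
      intro j hj
      rw [Finset.mem_erase] at hj
      exact (if_pos (h4 j hj.2 hj.1)).symm
    rw [e] at h1
    by_cases h5 : x - c * x < X i ω
    · exact Or.inl ⟨h5, (abs_le.1 h3).2⟩
    · refine Or.inr ⟨h2, ?_⟩
      have : c * x ≤ T ω := by push Not at h5; linarith
      exact this.trans (le_abs_self _)
  have hlaw : ∀ S : Set ℝ, MeasurableSet S → ℙ (X i ⁻¹' S) = Measure.map (X 0) ℙ S := by
    intro S hS
    rw [← (hident i).map_eq, Measure.map_apply (hmeas i) hS]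
  have hind : IndepFun (X i) T ℙ := by
    have h1 := hindep.indepFun_finset {i} s (by simp [hs]) hmeas
    have hφ : Measurable (fun v : (({i} : Finset ℕ) → ℝ) => v ⟨i, Finset.mem_singleton_self i⟩) :=
      measurable_pi_apply _
    have hψ : Measurable (fun v : (s → ℝ) => ∑ j : s, trc (c * x) (v j)) :=
      Finset.measurable_sum _ fun j _ => (trc_meas (c * x)).comp (measurable_pi_apply j)
    have h2 := h1.comp hφ hψ
    have hTe : T = (fun v : (s → ℝ) => ∑ j : s, trc (c * x) (v j)) ∘ (fun a (j : s) => X j a) := by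
      funext ω
      exact (Finset.sum_coe_sort s (fun j => trc (c * x) (X j ω))).symm
    rw [hTe]
    exact h2
  have hm1 : MeasurableSet {u : ℝ | c * x < |u|} := measurableSet_lt measurable_const (by fun_prop)
  have hm2 : MeasurableSet {u : ℝ | c * x ≤ |u|} := measurableSet_le measurable_const (by fun_prop)
  have hcx2 : c * x ≤ x / 2 := by nlinarith
  refine (measure_mono hsub).trans ((measure_union_le _ _).trans (add_le_add ?_ ?_))
  · rw [hlaw _ measurableSet_Ioc]
    refine (h.ioc_le (by linarith) (by linarith)).trans (ENNReal.ofReal_le_ofReal ?_)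
    rw [sub_sub_cancel]
    have : (x - c * x) ^ (-1 - α) ≤ (x / 2) ^ (-1 - α) :=
      Real.rpow_le_rpow_of_nonpos (by positivity) (by linarith) (by linarith)
    gcongr
  · rw [hind.measure_inter_preimage_eq_mul _ _ hm1 hm2, hlaw _ hm1]
    refine mul_le_mul' (h.tail_le hcx) ?_
    refine (sum_dev X hmeas hindep hident h hcx s).trans (ENNReal.ofReal_le_ofReal ?_)
    have hcard : (s.card : ℝ) ≤ n := by
      have := Finset.card_erase_le (s := Finset.range n) (a := i)
      rw [Finset.card_range] at this
      exact_mod_cast this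
    have : 0 < 2 - α := by linarith
    gcongr

lemma full_event {Ω : Type*} [MeasureSpace Ω] [IsProbabilityMeasure (ℙ : Measure Ω)]
    {α K u0 : ℝ} {f : ℝ → ℝ}
    (X : ℕ → Ω → ℝ) (hmeas : ∀ i, Measurable (X i))
    (hindep : iIndepFun X ℙ) (hident : ∀ i, IdentDistrib (X i) (X 0) ℙ ℙ)
    (h : TailLaw (Measure.map (X 0) ℙ) α K u0 f) (n : ℕ) (hn : 0 < n) (x c : ℝ) (hx : 0 < x) (hc : 0 < c)
    (hc2 : c ≤ 1 / 2) (hcx : u0 ≤ c * x) :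
    (ℙ {ω | (∑ i ∈ Finset.range n, X i ω) > x ∧ ∃ i ∈ Finset.range n, c * x < |X i ω| ∧ |X i ω| ≤ x ∧
      ∀ j ∈ Finset.range n, j ≠ i → |X j ω| ≤ c * x}).toReal / ((n : ℝ) * x ^ (-α)) ≤
    K * (1 / 2) ^ (-1 - α) * c + 2 * K / α * (u0 ^ α + 2 * K / (2 - α)) *
      ((n : ℝ) * x ^ (-α) / c ^ (2 * α)) := by
  have hα := h.a0
  have hα2 : 0 < 2 - α := by linarith [h.a2]
  have hK := h.Kpos
  have hu0 := h.u0pos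
  set B : ℝ := K * (x / 2) ^ (-1 - α) * (c * x) + 2 * K / α * (c * x) ^ (-α) *
      (n * ((u0 ^ α + 2 * K / (2 - α)) * (c * x) ^ (2 - α)) / (c * x) ^ 2) with hB
  have hB0 : 0 ≤ B := by positivity
  have hmain : ℙ {ω | (∑ i ∈ Finset.range n, X i ω) > x ∧ ∃ i ∈ Finset.range n, c * x < |X i ω| ∧ |X i ω| ≤ x ∧
      ∀ j ∈ Finset.range n, j ≠ i → |X j ω| ≤ c * x} ≤ ENNReal.ofReal (n * B) := by
    calc _ ≤ ℙ (⋃ i ∈ Finset.range n, {ω | (∑ i ∈ Finset.range n, X i ω) > x ∧ c * x < |X i ω| ∧ |X i ω| ≤ x ∧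
          ∀ j ∈ Finset.range n, j ≠ i → |X j ω| ≤ c * x}) := by
          apply measure_mono
          rintro ω ⟨h1, i, hi, h2⟩
          exact Set.mem_biUnion hi ⟨h1, h2⟩
      _ ≤ ∑ i ∈ Finset.range n, ENNReal.ofReal B := by
          refine (measure_biUnion_finset_le _ _).trans (Finset.sum_le_sum fun i hi => ?_)
          refine (one_event X hmeas hindep hident h n x c hx hc hc2 hcx i hi).trans (le_of_eq ?_)
          rw [← ENNReal.ofReal_mul (by positivity), ← ENNReal.ofReal_add (by positivity) (by positivity)]
      _ = _ := by
          rw [Finset.sum_const, Finset.card_range, nsmul_eq_mul, ENNReal.ofReal_mul (by positivity),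
            ENNReal.ofReal_natCast]
  have h2 := ENNReal.toReal_mono ENNReal.ofReal_ne_top hmain
  rw [ENNReal.toReal_ofReal (by positivity)] at h2
  have hn' : (0 : ℝ) < n := by exact_mod_cast hn
  rw [div_le_iff₀ (by positivity)]
  refine h2.trans (le_of_eq ?_)
  have e1 : (x / 2) ^ (-1 - α) * x = (1 / 2) ^ (-1 - α) * x ^ (-α) := by
    rw [show x / 2 = (1 / 2) * x by ring, Real.mul_rpow (by norm_num) hx.le, mul_assoc]
    congr 1
    rw [← Real.rpow_add_one hx.ne']; congr 1; ring
  have e2 : (c * x) ^ (-α) * ((c * x) ^ (2 - α) / (c * x) ^ 2) = x ^ (-α) * (x ^ (-α) / c ^ (2 * α)) := by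
    have hcx0 : 0 < c * x := by positivity
    have : (c * x) ^ (2 - α) / (c * x) ^ 2 = (c * x) ^ (-α) := by
      rw [← Real.rpow_natCast, ← Real.rpow_sub hcx0]; congr 1; push_cast; ring
    rw [this, Real.mul_rpow hc.le hx.le, div_eq_mul_inv, ← Real.rpow_neg hc.le,
      show -(2 * α) = -α + -α by ring, Real.rpow_add hc]
    ring
  calc (n : ℝ) * B = n * (K * ((x / 2) ^ (-1 - α) * x) * c + 2 * K / α * (u0 ^ α + 2 * K / (2 - α)) * n *
      ((c * x) ^ (-α) * ((c * x) ^ (2 - α) / (c * x) ^ 2))) := by rw [hB]; ring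
    _ = _ := by rw [e1, e2]; ring


theorem p_one_zero_small
    {Ω : Type*} [MeasureSpace Ω] [IsProbabilityMeasure (ℙ : Measure Ω)]
    (α : ℝ) (hα : α ∈ Set.Ioo (0 : ℝ) 2)
    (X : ℕ → Ω → ℝ) (hmeas : ∀ i, Measurable (X i))
    (hindep : iIndepFun X ℙ)
    (hident : ∀ i, IdentDistrib (X i) (X 0) ℙ ℙ)
    (hsymm : Measure.map (X 0) ℙ = Measure.map (fun ω => -(X 0 ω)) ℙ)
    (f : ℝ → ℝ) (hf0 : ∀ u, 0 ≤ f u) (hfmeas : Measurable f)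
    (hpdf : Measure.map (X 0) ℙ = (volume : Measure ℝ).withDensity (fun u => ENNReal.ofReal (f u)))
    (k0 K0 u0 : ℝ) (hk0 : 0 < k0) (hK0 : k0 ≤ K0) (hu0 : 0 < u0)
    (htail : ∀ u, u0 ≤ u → k0 * u ^ (-1 - α) ≤ f u ∧ f u ≤ K0 * u ^ (-1 - α))
    (n : ℕ → ℕ) (hn : ∀ k, 0 < n k)
    (x : ℕ → ℝ) (hx : ∀ k, 0 < x k)
    (c : ℕ → ℝ) (hc : ∀ k, c k ∈ Set.Ioo (0 : ℝ) 1)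
    (hLD : Tendsto (fun k => (n k : ℝ) / x k ^ α) atTop (nhds 0))
    (hcc : Tendsto (fun k => (n k : ℝ) * x k ^ (-α) / c k ^ (2 * α)) atTop (nhds 0))
    (hc0 : Tendsto c atTop (nhds 0))
:
    Tendsto (fun k => (ℙ {ω | (∑ i ∈ Finset.range (n k), X i ω) > x k ∧ ∃ i ∈ Finset.range (n k), c k * x k < |X i ω| ∧ |X i ω| ≤ x k ∧ ∀ j ∈ Finset.range (n k), j ≠ i → |X j ω| ≤ c k * x k}).toReal / ((n k : ℝ) * x k ^ (-α))) atTop (nhds 0) := by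
  have hK : 0 < K0 := hk0.trans_le hK0
  have hα0 : 0 < α := hα.1
  have h : TailLaw (Measure.map (X 0) ℙ) α K0 u0 f :=
    { prob := Measure.isProbabilityMeasure_map (hmeas 0).aemeasurable
      symm := by
        rw [Measure.map_map measurable_neg (hmeas 0)]
        exact hsymm
      fmeas := hfmeas
      pdf := hpdf
      Kpos := hK
      u0pos := hu0
      a0 := hα.1
      a2 := hα.2
      tail := fun u hu => (htail u hu).2 }
  have hlim : Tendsto (fun k => K0 * (1 / 2) ^ (-1 - α) * c k + 2 * K0 / α * (u0 ^ α + 2 * K0 / (2 - α)) *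
      ((n k : ℝ) * x k ^ (-α) / c k ^ (2 * α))) atTop (nhds 0) := by
    simpa using (hc0.const_mul (K0 * (1 / 2) ^ (-1 - α))).add
      (hcc.const_mul (2 * K0 / α * (u0 ^ α + 2 * K0 / (2 - α))))
  refine squeeze_zero' (Eventually.of_forall fun k => ?_) ?_ hlim
  · have := hx k
    positivity
  have ev1 : ∀ᶠ k in atTop, c k < 1 / 2 := hc0.eventually (gt_mem_nhds (by norm_num))
  have ev2 : ∀ᶠ k in atTop, (n k : ℝ) * x k ^ (-α) / c k ^ (2 * α) < u0 ^ (-α) :=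
    hcc.eventually (gt_mem_nhds (by positivity))
  filter_upwards [ev1, ev2] with k h1 h2
  have hxk := hx k
  obtain ⟨hck, hck1⟩ := hc k
  refine full_event X hmeas hindep hident h (n k) (hn k) (x k) (c k) hxk hck h1.le ?_
  by_contra h3
  push Not at h3
  have h4 : u0 ^ (-α) ≤ (c k * x k) ^ (-α) :=
    Real.rpow_le_rpow_of_nonpos (by positivity) h3.le (by linarith)
  have h5 : (c k * x k) ^ (-α) ≤ (n k : ℝ) * x k ^ (-α) / c k ^ (2 * α) := by
    rw [Real.mul_rpow hck.le hxk.le, div_eq_mul_inv, ← Real.rpow_neg hck.le]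
    have a1 : c k ^ (-α) ≤ c k ^ (-(2 * α)) :=
      Real.rpow_le_rpow_of_exponent_ge hck hck1.le (by linarith)
    have a2 : (1 : ℝ) ≤ n k := by exact_mod_cast hn k
    have a3 : x k ^ (-α) ≤ n k * x k ^ (-α) := le_mul_of_one_le_left (by positivity) a2
    rw [mul_comm]
    exact mul_le_mul a3 a1 (by positivity) (by positivity)
  linarith
end

section
/- Let α ∈ (0,2). Let X_1, X_2, … be independent identically distributed real random variables whose common distribution is symmetric about 0 and has a probability density function f satisfying f(u) ≍ u^{-1-α} as u → ∞. For n ∈ ℕ let S_n := X_1 + … + X_n, and for n ∈ ℕ, x > 0, c ∈ (0,1) define p_{1,1,-}(n,x,c) := P(S_n > x and there exists i ∈ {1,…,n} with X_i < −x and max_{j ∈ {1,…,n}, j ≠ i} |X_j| ≤ c x). Then for any sequences (n_k) of positive integers, (x_k) of positive reals, and (c_k) in (0,1) with n_k / x_k^α → 0, (n_k x_k^{-α}) / c_k^{2α} → 0, and c_k → 0, one has p_{1,1,-}(n_k, x_k, c_k) / (n_k x_k^{-α}) → 0 as k → ∞. -/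
open MeasureTheory ProbabilityTheory Filter

lemma aux_tail (ν : Measure ℝ) (α : ℝ) (hα : 0 < α)
    (hs : ν = ν.map (fun u => -u)) (f : ℝ → ℝ)
    (hpdf : ν = (volume : Measure ℝ).withDensity (fun u => ENNReal.ofReal (f u)))
    (K0 u0 : ℝ) (hu0 : 0 < u0)
    (htail : ∀ u, u0 ≤ u → f u ≤ K0 * u ^ (-1 - α)) (hK0 : 0 < K0)
    (x : ℝ) (hx : u0 ≤ x) :
    ν (Set.Iio (-x)) ≤ ENNReal.ofReal (K0 / α * x ^ (-α)) := by
  have hx0 : 0 < x := by linarith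
  have h1 : ν (Set.Iio (-x)) = ν (Set.Ioi x) := by
    conv_lhs => rw [hs]
    rw [Measure.map_apply measurable_neg measurableSet_Iio]
    congr 1
    ext u
    simp
  have hint : IntegrableOn (fun u : ℝ => K0 * u ^ (-1 - α)) (Set.Ioi x) :=
    (integrableOn_Ioi_rpow_of_lt (by linarith) hx0).const_mul K0
  have hI : ∫ u in Set.Ioi x, K0 * u ^ (-1 - α) = K0 / α * x ^ (-α) := by
    rw [integral_const_mul, integral_Ioi_rpow_of_lt (by linarith) hx0]
    have : -1 - α + 1 = -α := by ring
    rw [this]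
    field_simp
  rw [h1, hpdf, withDensity_apply _ measurableSet_Ioi, ← hI,
    ofReal_integral_eq_lintegral_ofReal hint]
  · apply setLIntegral_mono' measurableSet_Ioi
    intro u hu
    exact ENNReal.ofReal_le_ofReal (htail u (hx.trans (le_of_lt hu)))
  · filter_upwards [ae_restrict_mem measurableSet_Ioi] with u hu
    have : 0 < u := hx0.trans hu
    positivity

noncomputable def truncX (x u : ℝ) : ℝ := if |u| ≤ x then u else 0

lemma truncX_meas (x : ℝ) : Measurable (truncX x) := by
  unfold truncX
  exact Measurable.ite (measurableSet_le (by fun_prop) (by fun_prop)) measurable_id measurable_const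

lemma truncX_bound (x u : ℝ) (hx : 0 ≤ x) : |truncX x u| ≤ x := by
  unfold truncX
  split_ifs with h
  · exact h
  · simpa using hx

lemma truncX_neg (x u : ℝ) : truncX x (-u) = - truncX x u := by
  unfold truncX
  rw [abs_neg]
  split_ifs <;> simp

lemma aux_second (ν : Measure ℝ) [IsProbabilityMeasure ν] (α : ℝ) (hα2 : α < 2)
    (hs : ν = ν.map (fun u => -u)) (f : ℝ → ℝ) (hfmeas : Measurable f)
    (hpdf : ν = (volume : Measure ℝ).withDensity (fun u => ENNReal.ofReal (f u)))
    (K0 u0 : ℝ) (hu0 : 0 < u0)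
    (htail : ∀ u, u0 ≤ u → f u ≤ K0 * u ^ (-1 - α)) (hK0 : 0 < K0)
    (x : ℝ) (hx : u0 ≤ x) :
    ∫ u, (truncX x u) ^ 2 ∂ν ≤ (u0 ^ α + 2 * (K0 / (2 - α))) * x ^ (2 - α) := by
  have hx0 : 0 < x := by linarith
  set h : ℝ → ENNReal := (Set.Ioc u0 x).indicator (fun u => ENNReal.ofReal (u ^ 2)) with hh
  have hhm : Measurable h := Measurable.indicator (by fun_prop) measurableSet_Ioc
  have hneg : ∫⁻ u, h (-u) ∂ν = ∫⁻ u, h u ∂ν := by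
    conv_rhs => rw [hs]
    rw [lintegral_map hhm measurable_neg]
  have hint : IntegrableOn (fun u : ℝ => K0 * u ^ (1 - α)) (Set.Ioc 0 x) := by
    have := (intervalIntegral.intervalIntegrable_rpow' (a := 0) (b := x) (r := 1 - α) (by linarith))
    rw [intervalIntegrable_iff_integrableOn_Ioc_of_le hx0.le] at this
    exact this.const_mul K0
  have hI : ∫ u in Set.Ioc 0 x, K0 * u ^ (1 - α) = K0 / (2 - α) * x ^ (2 - α) := by
    rw [integral_const_mul, ← intervalIntegral.integral_of_le hx0.le,
      integral_rpow (Or.inl (by linarith))]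
    have : 1 - α + 1 = 2 - α := by ring
    rw [this, Real.zero_rpow (by linarith)]
    ring
  have hh1 : ∫⁻ u, h u ∂ν ≤ ENNReal.ofReal (K0 / (2 - α) * x ^ (2 - α)) := by
    rw [hpdf, lintegral_withDensity_eq_lintegral_mul _ (by fun_prop) hhm, ← hI,
      ofReal_integral_eq_lintegral_ofReal hint, ← lintegral_indicator measurableSet_Ioc]
    · apply lintegral_mono
      intro u
      simp only [Pi.mul_apply, hh]
      by_cases hu : u ∈ Set.Ioc u0 x
      · have hu' : u ∈ Set.Ioc 0 x := ⟨hu0.trans hu.1, hu.2⟩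
        rw [Set.indicator_of_mem hu, Set.indicator_of_mem hu', ← ENNReal.ofReal_mul' (sq_nonneg u)]
        apply ENNReal.ofReal_le_ofReal
        have e : u ^ (1 - α) = u ^ (-1 - α) * u ^ 2 := by
          rw [← Real.rpow_natCast, ← Real.rpow_add hu'.1]
          congr 1
          push_cast
          ring
        rw [e, ← mul_assoc]
        exact mul_le_mul_of_nonneg_right (htail u hu.1.le) (sq_nonneg u)
      · rw [Set.indicator_of_notMem hu]
        simp
    · filter_upwards [ae_restrict_mem measurableSet_Ioc] with u hu
      have : 0 < u := hu.1
      positivity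
  have hpt : ∀ u, ENNReal.ofReal ((truncX x u) ^ 2) ≤ ENNReal.ofReal (u0 ^ 2) + h u + h (-u) := by
    intro u
    unfold truncX
    split_ifs with hu
    · obtain ⟨ha, hb⟩ := abs_le.1 hu
      by_cases h1 : u0 < u
      · have : h u = ENNReal.ofReal (u ^ 2) := Set.indicator_of_mem (show u ∈ Set.Ioc u0 x from ⟨h1, hb⟩) _
        rw [← this, add_assoc, add_left_comm]
        exact le_self_add
      · by_cases h2 : u0 < -u
        · have : h (-u) = ENNReal.ofReal ((-u) ^ 2) :=
            Set.indicator_of_mem (show -u ∈ Set.Ioc u0 x from ⟨h2, by linarith⟩) _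
          rw [this, neg_sq]
          exact le_add_self
        · rw [add_assoc]
          refine le_trans (ENNReal.ofReal_le_ofReal ?_) le_self_add
          exact sq_le_sq' (by linarith) (by linarith)
    · simp
  have hB : 0 ≤ K0 / (2 - α) * x ^ (2 - α) := by
    have : 0 < 2 - α := by linarith
    positivity
  have hl : ∫⁻ u, ENNReal.ofReal ((truncX x u) ^ 2) ∂ν
      ≤ ENNReal.ofReal (u0 ^ 2 + K0 / (2 - α) * x ^ (2 - α) + K0 / (2 - α) * x ^ (2 - α)) := by
    calc _ ≤ ∫⁻ u, (ENNReal.ofReal (u0 ^ 2) + h u + h (-u)) ∂ν := lintegral_mono hpt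
      _ = ENNReal.ofReal (u0 ^ 2) + ∫⁻ u, h u ∂ν + ∫⁻ u, h (-u) ∂ν := by
        rw [lintegral_add_right _ (show Measurable (fun u => h (-u)) from hhm.comp measurable_neg),
          lintegral_add_right _ hhm]
        simp
      _ ≤ _ := by
        rw [hneg, ENNReal.ofReal_add (by positivity) hB, ENNReal.ofReal_add (by positivity) hB]
        gcongr
  have hr : ∫ u, (truncX x u) ^ 2 ∂ν
      ≤ u0 ^ 2 + K0 / (2 - α) * x ^ (2 - α) + K0 / (2 - α) * x ^ (2 - α) := by
    rw [integral_eq_lintegral_of_nonneg_ae (Eventually.of_forall fun u => sq_nonneg _)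
      ((truncX_meas x).pow_const 2).aestronglyMeasurable]
    exact ENNReal.toReal_le_of_le_ofReal (by positivity) hl
  have hu : u0 ^ 2 ≤ u0 ^ α * x ^ (2 - α) := by
    have e : u0 ^ 2 = u0 ^ α * u0 ^ (2 - α) := by
      rw [← Real.rpow_natCast, ← Real.rpow_add hu0]
      congr 1
      push_cast
      ring
    rw [e]
    gcongr
  linarith

lemma aux_main {Ω : Type*} [MeasureSpace Ω] [IsProbabilityMeasure (ℙ : Measure Ω)]
    (X : ℕ → Ω → ℝ) (hmeas : ∀ i, Measurable (X i))
    (hindep : iIndepFun X ℙ)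
    (hident : ∀ i, IdentDistrib (X i) (X 0) ℙ ℙ)
    (hsymm : Measure.map (X 0) ℙ = (Measure.map (X 0) ℙ).map (fun u => -u))
    (x A B c : ℝ) (hx : 0 < x) (hc : c < 1) (hA : 0 ≤ A)
    (h1 : Measure.map (X 0) ℙ (Set.Iio (-x)) ≤ ENNReal.ofReal A)
    (h2 : ∫ u, (truncX x u) ^ 2 ∂(Measure.map (X 0) ℙ) ≤ B) (n : ℕ) :
    (ℙ {ω | (∑ i ∈ Finset.range n, X i ω) > x ∧ ∃ i ∈ Finset.range n, X i ω < -x ∧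
      ∀ j ∈ Finset.range n, j ≠ i → |X j ω| ≤ c * x}).toReal ≤ n * (A * (n * B / x ^ 2)) := by
  have hB : 0 ≤ B := le_trans (integral_nonneg fun u => sq_nonneg _) h2
  have hYm : ∀ j, Measurable (fun ω => truncX x (X j ω)) := fun j => (truncX_meas x).comp (hmeas j)
  have hYL : ∀ j, MemLp (fun ω => truncX x (X j ω)) 2 ℙ := fun j =>
    MemLp.of_bound (hYm j).aestronglyMeasurable x
      (Eventually.of_forall fun ω => truncX_bound x _ hx.le)
  have hY0 : ∀ j, ∫ ω, truncX x (X j ω) ∂ℙ = 0 := by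
    intro j
    have e1 : ∫ ω, truncX x (X j ω) ∂ℙ = ∫ u, truncX x u ∂(Measure.map (X 0) ℙ) := by
      rw [← (hident j).map_eq, integral_map (hmeas j).aemeasurable
        (truncX_meas x).aestronglyMeasurable]
    have e2 : ∫ u, truncX x u ∂(Measure.map (X 0) ℙ)
        = - ∫ u, truncX x u ∂(Measure.map (X 0) ℙ) := by
      conv_lhs => rw [hsymm]
      rw [integral_map measurable_neg.aemeasurable (truncX_meas x).aestronglyMeasurable]
      simp only [truncX_neg, integral_neg]
    rw [e1]
    linarith
  have hYV : ∀ j, Var[fun ω => truncX x (X j ω); ℙ] ≤ B := by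
    intro j
    refine (variance_le_expectation_sq (hYm j).aestronglyMeasurable).trans ?_
    refine le_trans (le_of_eq ?_) h2
    rw [← (hident j).map_eq, integral_map (hmeas j).aemeasurable
        ((truncX_meas x).pow_const 2).aestronglyMeasurable]
    rfl
  have key : ∀ i ∈ Finset.range n,
      ℙ ((X i) ⁻¹' (Set.Iio (-x)) ∩
        {ω | x ≤ ∑ j ∈ (Finset.range n).erase i, truncX x (X j ω)})
      ≤ ENNReal.ofReal (A * (n * B / x ^ 2)) := by
    intro i hi
    set T := (Finset.range n).erase i
    have hd : Disjoint ({i} : Finset ℕ) T := by simp [T]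
    have hind := hindep.indepFun_finset {i} T hd hmeas
    have hind2 : IndepFun (X i) (fun ω => ∑ j ∈ T, truncX x (X j ω)) ℙ := by
      have m1 : Measurable (fun v : ({i} : Finset ℕ) → ℝ => v ⟨i, by simp⟩) :=
        measurable_pi_apply _
      have m2 : Measurable (fun v : T → ℝ => ∑ j : T, truncX x (v j)) :=
        Finset.measurable_sum _ fun j _ =>
          show Measurable (fun v : T → ℝ => truncX x (v j)) from
          (truncX_meas x).comp (measurable_pi_apply j)
      have := hind.comp m1 m2
      have e : (fun ω => ∑ j ∈ T, truncX x (X j ω)) = fun ω => ∑ j : T, truncX x (X j ω) := by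
        funext ω
        exact (Finset.sum_coe_sort T (fun j => truncX x (X j ω))).symm
      rw [e]
      exact this
    have e := hind2.measure_inter_preimage_eq_mul (Set.Iio (-x)) (Set.Ici x)
      measurableSet_Iio measurableSet_Ici
    have p1 : ℙ ((X i) ⁻¹' (Set.Iio (-x))) ≤ ENNReal.ofReal A := by
      rw [← Measure.map_apply (hmeas i) measurableSet_Iio, (hident i).map_eq]
      exact h1
    have hsum : (fun ω => ∑ j ∈ T, truncX x (X j ω)) = ∑ j ∈ T, fun ω => truncX x (X j ω) := by
      ext ω
      simp
    have hZL : MemLp (fun ω => ∑ j ∈ T, truncX x (X j ω)) 2 ℙ :=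
      memLp_finsetSum _ fun j _ => hYL j
    have hZ0 : ∫ ω, ∑ j ∈ T, truncX x (X j ω) ∂ℙ = 0 := by
      rw [integral_finsetSum _ fun j _ => (hYL j).integrable (by norm_num)]
      simp [hY0]
    have hZV : Var[fun ω => ∑ j ∈ T, truncX x (X j ω); ℙ] ≤ n * B := by
      rw [hsum, IndepFun.variance_sum (fun j _ => hYL j)
        (fun a _ b _ hab => (hindep.indepFun hab).comp (truncX_meas x) (truncX_meas x))]
      calc _ ≤ ∑ j ∈ T, B := Finset.sum_le_sum fun j _ => hYV j
        _ = T.card * B := by simp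
        _ ≤ n * B := by
          gcongr
          simpa using Finset.card_le_card (Finset.erase_subset i (Finset.range n))
    have p2 : ℙ ((fun ω => ∑ j ∈ T, truncX x (X j ω)) ⁻¹' (Set.Ici x))
        ≤ ENNReal.ofReal (n * B / x ^ 2) := by
      have := meas_ge_le_variance_div_sq hZL hx
      rw [hZ0] at this
      refine le_trans (measure_mono ?_) (this.trans (ENNReal.ofReal_le_ofReal (by gcongr)))
      intro ω hω
      simp only [Set.mem_preimage, Set.mem_Ici] at hω
      simp only [Set.mem_ofPred_eq, sub_zero]
      exact hω.trans (le_abs_self _)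
    rw [ENNReal.ofReal_mul hA]
    calc _ = _ := e
      _ ≤ _ := mul_le_mul' p1 p2
  have hsub : {ω | (∑ i ∈ Finset.range n, X i ω) > x ∧ ∃ i ∈ Finset.range n, X i ω < -x ∧
      ∀ j ∈ Finset.range n, j ≠ i → |X j ω| ≤ c * x} ⊆
      ⋃ i ∈ Finset.range n, ((X i) ⁻¹' (Set.Iio (-x)) ∩
        {ω | x ≤ ∑ j ∈ (Finset.range n).erase i, truncX x (X j ω)}) := by
    rintro ω ⟨hS, i, hi, hXi, hj⟩
    simp only [Set.mem_iUnion]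
    refine ⟨i, hi, hXi, ?_⟩
    have : ∑ j ∈ (Finset.range n).erase i, truncX x (X j ω)
        = ∑ j ∈ (Finset.range n).erase i, X j ω := by
      refine Finset.sum_congr rfl fun j hjm => ?_
      rw [Finset.mem_erase] at hjm
      have := hj j hjm.2 hjm.1
      unfold truncX
      rw [if_pos]
      nlinarith
    simp only [Set.mem_ofPred_eq]
    rw [this]
    have := Finset.add_sum_erase (Finset.range n) (fun j => X j ω) hi
    linarith
  apply ENNReal.toReal_le_of_le_ofReal (by positivity)
  refine (measure_mono hsub).trans ((measure_biUnion_finset_le _ _).trans ?_)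
  refine (Finset.sum_le_sum key).trans ?_
  rw [Finset.sum_const, Finset.card_range, nsmul_eq_mul, ENNReal.ofReal_mul (p := (n : ℝ)) (by positivity),
    ENNReal.ofReal_natCast]

theorem p_one_one_minus_small
    {Ω : Type*} [MeasureSpace Ω] [IsProbabilityMeasure (ℙ : Measure Ω)]
    (α : ℝ) (hα : α ∈ Set.Ioo (0 : ℝ) 2)
    (X : ℕ → Ω → ℝ) (hmeas : ∀ i, Measurable (X i))
    (hindep : iIndepFun X ℙ)
    (hident : ∀ i, IdentDistrib (X i) (X 0) ℙ ℙ)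
    (hsymm : Measure.map (X 0) ℙ = Measure.map (fun ω => -(X 0 ω)) ℙ)
    (f : ℝ → ℝ) (hf0 : ∀ u, 0 ≤ f u) (hfmeas : Measurable f)
    (hpdf : Measure.map (X 0) ℙ = (volume : Measure ℝ).withDensity (fun u => ENNReal.ofReal (f u)))
    (k0 K0 u0 : ℝ) (hk0 : 0 < k0) (hK0 : k0 ≤ K0) (hu0 : 0 < u0)
    (htail : ∀ u, u0 ≤ u → k0 * u ^ (-1 - α) ≤ f u ∧ f u ≤ K0 * u ^ (-1 - α))
    (n : ℕ → ℕ) (hn : ∀ k, 0 < n k)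
    (x : ℕ → ℝ) (hx : ∀ k, 0 < x k)
    (c : ℕ → ℝ) (hc : ∀ k, c k ∈ Set.Ioo (0 : ℝ) 1)
    (hLD : Tendsto (fun k => (n k : ℝ) / x k ^ α) atTop (nhds 0))
    (hcc : Tendsto (fun k => (n k : ℝ) * x k ^ (-α) / c k ^ (2 * α)) atTop (nhds 0))
    (hc0 : Tendsto c atTop (nhds 0))
:
    Tendsto (fun k => (ℙ {ω | (∑ i ∈ Finset.range (n k), X i ω) > x k ∧ ∃ i ∈ Finset.range (n k), X i ω < -x k ∧ ∀ j ∈ Finset.range (n k), j ≠ i → |X j ω| ≤ c k * x k}).toReal / ((n k : ℝ) * x k ^ (-α))) atTop (nhds 0) := by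
  obtain ⟨hα0, hα2⟩ := hα
  have hK : 0 < K0 := lt_of_lt_of_le hk0 hK0
  have hs : Measure.map (X 0) ℙ = (Measure.map (X 0) ℙ).map (fun u => -u) := by
    rw [Measure.map_map measurable_neg (hmeas 0)]
    exact hsymm
  haveI : IsProbabilityMeasure (Measure.map (X 0) (ℙ : Measure Ω)) :=
    Measure.isProbabilityMeasure_map (hmeas 0).aemeasurable
  set a := K0 / α with ha
  set b := u0 ^ α + 2 * (K0 / (2 - α)) with hb
  have ha0 : 0 < a := by positivity
  have hev : ∀ᶠ k in atTop, u0 ≤ x k := by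
    have hpos : 0 < 1 / u0 ^ α := by positivity
    filter_upwards [hLD.eventually (gt_mem_nhds hpos)] with k hk
    by_contra hlt
    push Not at hlt
    have h1 : x k ^ α ≤ u0 ^ α := Real.rpow_le_rpow (hx k).le hlt.le hα0.le
    have hxk : 0 < x k ^ α := Real.rpow_pos_of_pos (hx k) _
    have h2 : (1 : ℝ) ≤ n k := by exact_mod_cast hn k
    have : 1 / u0 ^ α ≤ (n k : ℝ) / x k ^ α := by gcongr
    linarith
  have hlim : Tendsto (fun k => a * b * ((n k : ℝ) / x k ^ α)) atTop (nhds 0) := by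
    simpa using hLD.const_mul (a * b)
  refine squeeze_zero' (Eventually.of_forall fun k => ?_) ?_ hlim
  · have := hx k
    positivity
  · filter_upwards [hev] with k hk
    have hxk := hx k
    have hnk : (0 : ℝ) < n k := by exact_mod_cast hn k
    have h1 := aux_tail _ α hα0 hs f hpdf K0 u0 hu0 (fun u hu => (htail u hu).2) hK (x k) hk
    have h2 := aux_second _ α hα2 hs f hfmeas hpdf K0 u0 hu0
      (fun u hu => (htail u hu).2) hK (x k) hk
    have h3 := aux_main X hmeas hindep hident hs (x k) _ _ (c k) hxk (hc k).2 (by positivity)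
      h1 h2 (n k)
    rw [div_le_iff₀ (by positivity)]
    refine h3.trans (le_of_eq ?_)
    have e1 : x k ^ (2 - α) = x k ^ 2 * x k ^ (-α) := by
      rw [← Real.rpow_natCast, ← Real.rpow_add hxk]
      congr 1
    rw [e1, ← ha, ← hb, Real.rpow_neg hxk.le]
    field_simp
end
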